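/- For every β ∈ ℝ, lim_{d→∞} limsup_{n→∞} | E_g[⟨R_{1,2}(σ1,σ2)²⟩^bis_{β,g}] − E_A[⟨R_{1,2}(σ1,σ2)²⟩^bis_{β/√d,A}] | = 0, where the inner Gibbs averages are over two independent samples from the bisection Gibbs measures μ^bis_{β,g} and μ^bis_{β/√d,A} respectively, and the outer expectations are over the SK disorder g and the sparse disorder A. -/

import Mathlib

open MeasureTheory ProbabilityTheory Filter

noncomputable section

/-- The value of a ±1 spin encoded as a Boolean. -/
def spin (b : Bool) : ℝ := if b then 1 else -1

/-- The Ising Hamiltonian `H(σ; X) = ∑_{i,j} X i j σ(i) σ(j)`. -/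
def Ham {n : ℕ} (X : Fin n → Fin n → ℝ) (σ : Fin n → Bool) : ℝ :=
  ∑ i, ∑ j, X i j * spin (σ i) * spin (σ j)

/-- The partition function `Z(β, X)`. -/
def Zpart {n : ℕ} (β : ℝ) (X : Fin n → Fin n → ℝ) : ℝ :=
  ∑ σ : Fin n → Bool, Real.exp (-β * Ham X σ)

/-- The Gibbs probability mass function `μ_{β,X}(σ)`. -/
def gibbs {n : ℕ} (β : ℝ) (X : Fin n → Fin n → ℝ) (σ : Fin n → Bool) : ℝ :=
  Real.exp (-β * Ham X σ) / Zpart β X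

/-- A configuration is a bisection if `|∑ i σ(i)| ≤ 1`. -/
def isBis {n : ℕ} (σ : Fin n → Bool) : Prop := |∑ i, spin (σ i)| ≤ 1

open scoped Classical in
/-- The bisection partition function `Z^bis(β, X)`. -/
def ZpartBis {n : ℕ} (β : ℝ) (X : Fin n → Fin n → ℝ) : ℝ :=
  ∑ σ : Fin n → Bool, if isBis σ then Real.exp (-β * Ham X σ) else 0

open scoped Classical in
/-- The bisection Gibbs probability mass function `μ^bis_{β,X}(σ)`. -/
def gibbsBis {n : ℕ} (β : ℝ) (X : Fin n → Fin n → ℝ) (σ : Fin n → Bool) : ℝ :=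
  if isBis σ then Real.exp (-β * Ham X σ) / ZpartBis β X else 0

/-- The overlap `R_{1,2}(σ1, σ2) = (1/n) ∑ i σ1(i) σ2(i)`. -/
def overlap {n : ℕ} (σ1 σ2 : Fin n → Bool) : ℝ :=
  (1 / (n : ℝ)) * ∑ i, spin (σ1 i) * spin (σ2 i)

/-- Gibbs average of a one-variable observable. -/
def avg1 {n : ℕ} (β : ℝ) (X : Fin n → Fin n → ℝ) (f : (Fin n → Bool) → ℝ) : ℝ :=
  ∑ σ : Fin n → Bool, f σ * gibbs β X σ

/-- Bisection Gibbs average of a one-variable observable. -/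
def avg1Bis {n : ℕ} (β : ℝ) (X : Fin n → Fin n → ℝ) (f : (Fin n → Bool) → ℝ) : ℝ :=
  ∑ σ : Fin n → Bool, f σ * gibbsBis β X σ

/-- Coupled Gibbs average: `σ1 ~ μ_{β,X}`, `σ2 ~ μ_{β,Y}` independent. -/
def avg2c {n : ℕ} (β : ℝ) (X Y : Fin n → Fin n → ℝ)
    (f : (Fin n → Bool) → (Fin n → Bool) → ℝ) : ℝ :=
  ∑ σ1 : Fin n → Bool, ∑ σ2 : Fin n → Bool, f σ1 σ2 * gibbs β X σ1 * gibbs β Y σ2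

/-- Gibbs average of a two-replica observable. -/
def avg2 {n : ℕ} (β : ℝ) (X : Fin n → Fin n → ℝ)
    (f : (Fin n → Bool) → (Fin n → Bool) → ℝ) : ℝ :=
  avg2c β X X f

/-- Coupled bisection Gibbs average. -/
def avg2cBis {n : ℕ} (β : ℝ) (X Y : Fin n → Fin n → ℝ)
    (f : (Fin n → Bool) → (Fin n → Bool) → ℝ) : ℝ :=
  ∑ σ1 : Fin n → Bool, ∑ σ2 : Fin n → Bool, f σ1 σ2 * gibbsBis β X σ1 * gibbsBis β Y σ2

/-- Bisection Gibbs average of a two-replica observable. -/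
def avg2Bis {n : ℕ} (β : ℝ) (X : Fin n → Fin n → ℝ)
    (f : (Fin n → Bool) → (Fin n → Bool) → ℝ) : ℝ :=
  avg2cBis β X X f

/-- The SK disorder: i.i.d. entries `N(0, 1/(2n))`. -/
def skMeasure (n : ℕ) : Measure (Fin n → Fin n → ℝ) :=
  Measure.pi fun _ => Measure.pi fun _ => gaussianReal 0 (1 / (2 * n))

/-- The law of the pair `(g, g')` of independent SK disorders. -/
def skPair (n : ℕ) : Measure ((Fin n → Fin n → ℝ) × (Fin n → Fin n → ℝ)) :=
  (skMeasure n).prod (skMeasure n)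

/-- The perturbed SK disorder `g_t = √(1-t) g + √t g'`. -/
def skPerturb {n : ℕ} (t : ℝ) (g g' : Fin n → Fin n → ℝ) : Fin n → Fin n → ℝ :=
  fun i j => Real.sqrt (1 - t) * g i j + Real.sqrt t * g' i j

/-- The sparse disorder: i.i.d. entries `Poisson(d/(2n))`. -/
def sparseMeasure (n : ℕ) (d : ℝ) : Measure (Fin n → Fin n → ℕ) :=
  Measure.pi fun _ => Measure.pi fun _ => poissonMeasure (d / (2 * n)).toNNReal

/-- The law of the triple `(A^{(1-t)}, A^{(t,1)}, A^{(t,2)})` of independent sparse disorders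
used to build the coupled pair `A = A^{(1-t)} + A^{(t,1)}`, `A_t = A^{(1-t)} + A^{(t,2)}`. -/
def coupledSparse (n : ℕ) (d t : ℝ) :
    Measure ((Fin n → Fin n → ℕ) × (Fin n → Fin n → ℕ) × (Fin n → Fin n → ℕ)) :=
  (sparseMeasure n ((1 - t) * d)).prod
    ((sparseMeasure n (t * d)).prod (sparseMeasure n (t * d)))

/-- View an ℕ-valued matrix as a real matrix. -/
def natMat {n : ℕ} (A : Fin n → Fin n → ℕ) : Fin n → Fin n → ℝ := fun i j => (A i j : ℝ)

/-- The Gibbs measure `μ_{β,X}` as a probability measure on configurations. -/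
def gibbsMeasure {n : ℕ} (β : ℝ) (X : Fin n → Fin n → ℝ) : Measure (Fin n → Bool) :=
  ∑ σ : Fin n → Bool, ENNReal.ofReal (gibbs β X σ) • Measure.dirac σ

/-- The bisection Gibbs measure `μ^bis_{β,X}` as a measure on configurations. -/
def gibbsBisMeasure {n : ℕ} (β : ℝ) (X : Fin n → Fin n → ℝ) : Measure (Fin n → Bool) :=
  ∑ σ : Fin n → Bool, ENNReal.ofReal (gibbsBis β X σ) • Measure.dirac σ

/-- Normalized Wasserstein distance `W_{2,n}` between measures on `{-1,1}^n`. -/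
def W2 (n : ℕ) (μ1 μ2 : Measure (Fin n → Bool)) : ℝ :=
  sInf {r : ℝ | ∃ π : Measure ((Fin n → Bool) × (Fin n → Bool)),
    IsProbabilityMeasure π ∧ π.map Prod.fst = μ1 ∧ π.map Prod.snd = μ2 ∧
    r = Real.sqrt (∫ p, (1 / (n : ℝ)) * ∑ i, (spin (p.1 i) - spin (p.2 i)) ^ 2 ∂π)}

open scoped Classical in
/-- Overlap-restricted coupled partition function `Z^S_{X,Y}`. -/
def Zres {n : ℕ} (β : ℝ) (S : Set ℝ) (X Y : Fin n → Fin n → ℝ) : ℝ :=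
  ∑ σ1 : Fin n → Bool, ∑ σ2 : Fin n → Bool,
    if overlap σ1 σ2 ∈ S then Real.exp (-β * (Ham X σ1 + Ham Y σ2)) else 0

open scoped Classical in
/-- Overlap-restricted coupled bisection partition function `Z^{S,bis}_{X,Y}`. -/
def ZresBis {n : ℕ} (β : ℝ) (S : Set ℝ) (X Y : Fin n → Fin n → ℝ) : ℝ :=
  ∑ σ1 : Fin n → Bool, ∑ σ2 : Fin n → Bool,
    if isBis σ1 ∧ isBis σ2 ∧ overlap σ1 σ2 ∈ S
    then Real.exp (-β * (Ham X σ1 + Ham Y σ2)) else 0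

/-- The matrix with a single `1` in position `(i,j)`. -/
def Jmat {n : ℕ} (i j : Fin n) : Fin n → Fin n → ℝ :=
  fun a b => if a = i ∧ b = j then 1 else 0

end

section LogSumExp

variable {T : Type*} [Fintype T]

/-- The log-partition function `log ∑ exp (Y t)` of an energy profile `Y`. -/
noncomputable def lse (Y : T → ℝ) : ℝ := Real.log (∑ t, Real.exp (Y t))

/-- The average of `f` under the Gibbs weights proportional to `exp (Y t)`. -/
noncomputable def gavg (Y f : T → ℝ) : ℝ :=
  (∑ t, f t * Real.exp (Y t)) / ∑ t, Real.exp (Y t)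

/-- The variance of `f` under the Gibbs weights proportional to `exp (Y t)`. -/
noncomputable def gvar (Y f : T → ℝ) : ℝ :=
  gavg Y (fun t => f t ^ 2) - gavg Y f ^ 2

lemma gavg_const_mul (Y f : T → ℝ) (a : ℝ) : gavg Y (fun t => a * f t) = a * gavg Y f := by
  simp only [gavg, mul_assoc, ← Finset.mul_sum, mul_div_assoc]

lemma gavg_sum {K : Type*} (s : Finset K) (Y : T → ℝ) (f : K → T → ℝ) :
    gavg Y (fun t => ∑ k ∈ s, f k t) = ∑ k ∈ s, gavg Y (f k) := by
  simp only [gavg, Finset.sum_mul, ← Finset.sum_div]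
  rw [Finset.sum_comm]

lemma gavg_mono (Y : T → ℝ) {f h : T → ℝ} (hfh : ∀ t, f t ≤ h t) : gavg Y f ≤ gavg Y h := by
  unfold gavg
  gcongr
  exact hfh _

lemma hasDerivAt_sum_mul_exp (W Y f : T → ℝ) (s : ℝ) :
    HasDerivAt (fun s : ℝ => ∑ t, f t * Real.exp (W t + s * Y t))
      (∑ t, f t * Y t * Real.exp (W t + s * Y t)) s := by
  have : ∀ t ∈ Finset.univ, HasDerivAt (fun s : ℝ => f t * Real.exp (W t + s * Y t))
      (f t * Y t * Real.exp (W t + s * Y t)) s := by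
    intro t _
    refine (((((hasDerivAt_id' s).mul_const (Y t)).const_add (W t)).exp).const_mul
      (f t)).congr_deriv ?_
    ring
  exact HasDerivAt.fun_sum this

variable [Nonempty T]

lemma sum_exp_pos (Y : T → ℝ) : 0 < ∑ t, Real.exp (Y t) :=
  Finset.sum_pos (fun _ _ => Real.exp_pos _) Finset.univ_nonempty

lemma gavg_const (Y : T → ℝ) (a : ℝ) : gavg Y (fun _ => a) = a := by
  rw [gavg, ← Finset.mul_sum, mul_div_assoc, div_self (sum_exp_pos Y).ne', mul_one]

lemma abs_gavg_le (Y : T → ℝ) {f : T → ℝ} {M : ℝ} (hf : ∀ t, |f t| ≤ M) : |gavg Y f| ≤ M := by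
  rw [abs_le]
  constructor
  · rw [← gavg_const Y (-M)]
    exact gavg_mono Y fun t => (abs_le.1 (hf t)).1
  · rw [← gavg_const Y M]
    exact gavg_mono Y fun t => (abs_le.1 (hf t)).2

/-- The log-partition function lies above its tangents. -/
lemma gavg_sub_le_lse_sub (Y Y' : T → ℝ) : gavg Y (fun t => Y' t - Y t) ≤ lse Y' - lse Y := by
  set m := gavg Y (fun t => Y' t - Y t) with hm
  have hZ := sum_exp_pos Y
  have key : Real.exp m * ∑ t, Real.exp (Y t) ≤ ∑ t, Real.exp (Y' t) := by
    have h1 : ∀ t, Real.exp m * (Real.exp (Y t) + (Y' t - Y t - m) * Real.exp (Y t))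
        ≤ Real.exp (Y' t) := by
      intro t
      have h2 := Real.add_one_le_exp (Y' t - Y t - m)
      have h3 : Real.exp (Y' t) = Real.exp m * (Real.exp (Y t) * Real.exp (Y' t - Y t - m)) := by
        rw [← Real.exp_add, ← Real.exp_add]; ring_nf
      rw [h3]
      gcongr
      nlinarith [Real.exp_pos (Y t)]
    refine le_trans (le_of_eq ?_) (Finset.sum_le_sum fun t _ => h1 t)
    have h4 : ∑ t, (Y' t - Y t) * Real.exp (Y t) = m * ∑ t, Real.exp (Y t) := by
      rw [hm, gavg, div_mul_cancel₀ _ hZ.ne']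
    rw [← Finset.mul_sum, Finset.sum_add_distrib]
    simp only [sub_mul _ m, Finset.sum_sub_distrib, ← Finset.mul_sum, h4]
    ring
  have := Real.log_le_log (by positivity) key
  rw [Real.log_mul (Real.exp_pos m).ne' hZ.ne', Real.log_exp] at this
  simp only [lse]
  linarith

lemma abs_lse_sub_le {Y Y' : T → ℝ} {M : ℝ} (h : ∀ t, |Y' t - Y t| ≤ M) :
    |lse Y' - lse Y| ≤ M := by
  have h1 := gavg_sub_le_lse_sub Y Y'
  have h2 := gavg_sub_le_lse_sub Y' Y
  have h3 := abs_le.1 (abs_gavg_le Y h)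
  have h4 := abs_le.1 (abs_gavg_le Y' (f := fun t => Y t - Y' t) (M := M)
    fun t => by rw [abs_sub_comm]; exact h t)
  rw [abs_le]
  constructor <;> linarith

lemma hasDerivAt_lse (W Y : T → ℝ) (s : ℝ) :
    HasDerivAt (fun s : ℝ => lse fun t => W t + s * Y t)
      (gavg (fun t => W t + s * Y t) Y) s := by
  have h := hasDerivAt_sum_mul_exp W Y (fun _ => 1) s
  simp only [one_mul] at h
  exact h.log (sum_exp_pos _).ne'

lemma hasDerivAt_gavg (W Y f : T → ℝ) (s : ℝ) :
    HasDerivAt (fun s : ℝ => gavg (fun t => W t + s * Y t) f)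
      (gavg (fun t => W t + s * Y t) (fun t => f t * Y t)
        - gavg (fun t => W t + s * Y t) f * gavg (fun t => W t + s * Y t) Y) s := by
  have h1 := hasDerivAt_sum_mul_exp W Y f s
  have h2 := hasDerivAt_sum_mul_exp W Y (fun _ => 1) s
  simp only [one_mul] at h2
  have hZ := (sum_exp_pos fun t => W t + s * Y t).ne'
  refine (h1.div h2 hZ).congr_deriv ?_
  have h : ∀ a b c z : ℝ, z ≠ 0 → (a * z - b * c) / z ^ 2 = a / z - b / z * (c / z) := by
    intro a b c z hz
    field_simp
  exact h _ _ _ _ hZ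

lemma abs_sub_le_of_hasDerivAt {f f' : ℝ → ℝ} {C s : ℝ} (hf : ∀ r, HasDerivAt f (f' r) r)
    (hC : ∀ r, |r| ≤ |s| → |f' r| ≤ C) : |f s - f 0| ≤ C * |s| := by
  have h := (convex_uIcc (0 : ℝ) s).norm_image_sub_le_of_norm_hasDerivWithin_le (f := f)
    (f' := f') (C := C) (x := 0) (y := s) (fun r _ => (hf r).hasDerivWithinAt)
    (fun r hr => hC r (by simpa using Set.abs_sub_left_of_mem_uIcc hr))
    Set.left_mem_uIcc Set.right_mem_uIcc
  simpa using h

lemma abs_gvar_add_mul_sub_le (W Y : T → ℝ) {M : ℝ} (hY : ∀ t, |Y t| ≤ M) (s : ℝ) :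
    |gvar (fun t => W t + s * Y t) Y - gvar W Y| ≤ 6 * M ^ 3 * |s| := by
  have hM : 0 ≤ M := (abs_nonneg _).trans (hY (Classical.arbitrary T))
  have hd : ∀ r, HasDerivAt (fun s : ℝ => gvar (fun t => W t + s * Y t) Y) _ r := fun r =>
    (hasDerivAt_gavg W Y (fun t => Y t ^ 2) r).sub ((hasDerivAt_gavg W Y Y r).pow 2)
  have h := abs_sub_le_of_hasDerivAt (s := s) (C := 6 * M ^ 3) hd ?_
  · simpa using h
  intro r _
  set V : T → ℝ := fun t => W t + r * Y t
  have h1 : |gavg V Y| ≤ M := abs_gavg_le V hY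
  have h2 : |gavg V (fun t => Y t ^ 2)| ≤ M ^ 2 := abs_gavg_le V fun t => by
    rw [abs_pow]; gcongr; exact hY t
  have h2' : |gavg V (fun t => Y t * Y t)| ≤ M ^ 2 := by simpa only [sq] using h2
  have h3 : |gavg V (fun t => Y t ^ 2 * Y t)| ≤ M ^ 3 := abs_gavg_le V fun t => by
    rw [← pow_succ, abs_pow]; gcongr; exact hY t
  have h4 : |gavg V (fun t => Y t ^ 2) * gavg V Y| ≤ M ^ 3 := by
    rw [abs_mul, pow_succ]; gcongr
  have h5 : |gavg V Y * gavg V (fun t => Y t * Y t)| ≤ M ^ 3 := by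
    rw [abs_mul, pow_succ']; gcongr
  have h6 : |gavg V Y ^ 3| ≤ M ^ 3 := by rw [abs_pow]; gcongr
  rw [abs_le] at *
  constructor <;> norm_num <;> nlinarith

lemma abs_gavg_add_mul_sub_le (W Y : T → ℝ) {M : ℝ} (hY : ∀ t, |Y t| ≤ M) (s : ℝ) :
    |gavg (fun t => W t + s * Y t) Y - gavg W Y - s * gvar W Y| ≤ 6 * M ^ 3 * |s| ^ 2 := by
  have hM : 0 ≤ M := (abs_nonneg _).trans (hY (Classical.arbitrary T))
  have hd : ∀ r, HasDerivAt (fun s : ℝ => gavg (fun t => W t + s * Y t) Y - s * gvar W Y)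
      (gvar (fun t => W t + r * Y t) Y - gvar W Y) r := fun r => by
    refine ((hasDerivAt_gavg W Y Y r).sub
      ((hasDerivAt_id' r).mul_const (gvar W Y))).congr_deriv ?_
    simp only [gvar, sq, one_mul]
  have h := abs_sub_le_of_hasDerivAt (s := s) (C := 6 * M ^ 3 * |s|) hd fun r hr =>
    (abs_gvar_add_mul_sub_le W Y hY r).trans (by gcongr)
  simp only [zero_mul, add_zero, sub_zero] at h
  calc _ = |gavg (fun t => W t + s * Y t) Y - s * gvar W Y - gavg W Y| := by
        rw [sub_right_comm]
    _ ≤ _ := h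
    _ = _ := by ring

/-- Second-order expansion of the log-partition function in one direction. -/
lemma abs_lse_add_mul_sub_le (W Y : T → ℝ) {M : ℝ} (hY : ∀ t, |Y t| ≤ M) (s : ℝ) :
    |lse (fun t => W t + s * Y t) - lse W - s * gavg W Y - s ^ 2 / 2 * gvar W Y|
      ≤ 6 * M ^ 3 * |s| ^ 3 := by
  have hM : 0 ≤ M := (abs_nonneg _).trans (hY (Classical.arbitrary T))
  have hd : ∀ r, HasDerivAt
      (fun s : ℝ => lse (fun t => W t + s * Y t) - s * gavg W Y - s ^ 2 / 2 * gvar W Y)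
      (gavg (fun t => W t + r * Y t) Y - gavg W Y - r * gvar W Y) r := fun r => by
    refine (((hasDerivAt_lse W Y r).sub ((hasDerivAt_id' r).mul_const (gavg W Y))).sub
      ((((hasDerivAt_id' r).pow 2).div_const 2).mul_const (gvar W Y))).congr_deriv ?_
    simp
  have h := abs_sub_le_of_hasDerivAt (s := s) (C := 6 * M ^ 3 * |s| ^ 2) hd fun r hr =>
    (abs_gavg_add_mul_sub_le W Y hY r).trans (by gcongr)
  simp only [zero_mul, add_zero, sub_zero] at h
  calc _ = |lse (fun t => W t + s * Y t) - s * gavg W Y - s ^ 2 / 2 * gvar W Y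
        - (lse W - 0 ^ 2 / 2 * gvar W Y)| := by congr 1; ring
    _ ≤ _ := h
    _ = _ := by ring

end LogSumExp

lemma integrable_fun_sub {Ω : Type*} [MeasurableSpace Ω] {μ : Measure Ω} {f h : Ω → ℝ}
    (hf : Integrable f μ) (hh : Integrable h μ) : Integrable (fun x => f x - h x) μ :=
  hf.sub hh

section ProductMeasure

lemma isProbabilityMeasure_update {ι : Type*} [DecidableEq ι] {μ : ι → Measure ℝ} {ρ : Measure ℝ}
    (hμ : ∀ k, IsProbabilityMeasure (μ k)) (hρ : IsProbabilityMeasure ρ) (i k : ι) :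
    IsProbabilityMeasure (Function.update μ i ρ k) := by
  rcases eq_or_ne k i with rfl | h
  · simpa using hρ
  · simpa [h] using hμ k

variable {ι : Type*} [Fintype ι]

/-- Resampling one coordinate of a product measure. -/
lemma map_update_pi_prod [DecidableEq ι] (μ : ι → Measure ℝ) (ρ : Measure ℝ)
    [hμ : ∀ k, IsProbabilityMeasure (μ k)] [hρ : IsProbabilityMeasure ρ] (i : ι) :
    ((Measure.pi μ).prod ρ).map (fun p => Function.update p.1 i p.2)
      = Measure.pi (Function.update μ i ρ) := by
  have := isProbabilityMeasure_update hμ hρ i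
  symm
  refine Measure.pi_eq fun s hs => ?_
  rw [Measure.map_apply (by fun_prop) (MeasurableSet.univ_pi hs)]
  have hpre : (fun p : (ι → ℝ) × ℝ => Function.update p.1 i p.2) ⁻¹' (Set.univ.pi s)
      = (Set.univ.pi (Function.update s i Set.univ)) ×ˢ s i := by
    ext p
    simp only [Set.mem_preimage, Set.mem_univ_pi, Set.mem_prod]
    constructor
    · intro h
      refine ⟨fun k => ?_, by simpa using h i⟩
      rcases eq_or_ne k i with rfl | hk
      · simp
      · simpa [hk] using h k
    · rintro ⟨h1, h2⟩ k
      rcases eq_or_ne k i with rfl | hk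
      · simpa using h2
      · simpa [hk] using h1 k
  rw [hpre, Measure.prod_prod, Measure.pi_pi,
    ← Finset.mul_prod_erase Finset.univ _ (Finset.mem_univ i),
    ← Finset.mul_prod_erase Finset.univ (fun k => Function.update μ i ρ k (s k))
      (Finset.mem_univ i)]
  simp only [Function.update_self, measure_univ, one_mul]
  rw [mul_comm]
  congr 1
  refine Finset.prod_congr rfl fun k hk => ?_
  simp [Finset.ne_of_mem_erase hk]

lemma integrable_update_pi_prod [DecidableEq ι] {μ : ι → Measure ℝ} {ρ : Measure ℝ}
    [∀ k, IsProbabilityMeasure (μ k)] [IsProbabilityMeasure ρ] {i : ι} {f : (ι → ℝ) → ℝ}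
    (hf : Integrable f (Measure.pi (Function.update μ i ρ))) :
    Integrable (fun p : (ι → ℝ) × ℝ => f (Function.update p.1 i p.2))
      ((Measure.pi μ).prod ρ) := by
  rw [← map_update_pi_prod] at hf
  exact hf.comp_measurable (by fun_prop)

lemma integral_pi_update [DecidableEq ι] {μ : ι → Measure ℝ} {ρ : Measure ℝ}
    [∀ k, IsProbabilityMeasure (μ k)] [IsProbabilityMeasure ρ] {i : ι} {f : (ι → ℝ) → ℝ}
    (hf : Integrable f (Measure.pi (Function.update μ i ρ))) :
    ∫ x, f x ∂(Measure.pi (Function.update μ i ρ))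
      = ∫ x, ∫ y, f (Function.update x i y) ∂ρ ∂(Measure.pi μ) := by
  rw [← integral_prod _ (integrable_update_pi_prod hf), ← map_update_pi_prod,
    integral_map (by fun_prop)]
  rw [map_update_pi_prod]
  exact hf.aestronglyMeasurable

/-- Changing the law of one coordinate changes an integral by at most the worst conditional
change. -/
lemma abs_integral_pi_update_sub_le [DecidableEq ι] {μ : ι → Measure ℝ} {ρ ρ' : Measure ℝ}
    [∀ k, IsProbabilityMeasure (μ k)] [IsProbabilityMeasure ρ] [IsProbabilityMeasure ρ'] {i : ι}
    {f h : (ι → ℝ) → ℝ}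
    (hf : Integrable f (Measure.pi (Function.update μ i ρ)))
    (hh : Integrable h (Measure.pi (Function.update μ i ρ'))) {δ : ℝ}
    (hδ : ∀ x, |∫ y, f (Function.update x i y) ∂ρ - ∫ y, h (Function.update x i y) ∂ρ'| ≤ δ) :
    |∫ x, f x ∂(Measure.pi (Function.update μ i ρ))
      - ∫ x, h x ∂(Measure.pi (Function.update μ i ρ'))| ≤ δ := by
  rw [integral_pi_update hf, integral_pi_update hh,
    ← integral_sub (integrable_update_pi_prod hf).integral_prod_left
      (integrable_update_pi_prod hh).integral_prod_left]
  have := norm_integral_le_of_norm_le_const (μ := Measure.pi μ) (C := δ)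
    (f := fun x => ∫ y, f (Function.update x i y) ∂ρ - ∫ y, h (Function.update x i y) ∂ρ')
    (ae_of_all _ hδ)
  simpa using this

lemma integrable_pi_of_linear_growth {μ : ι → Measure ℝ} [∀ k, IsProbabilityMeasure (μ k)]
    (hμ : ∀ k, Integrable (fun x => x) (μ k)) {f : (ι → ℝ) → ℝ} (hf : Continuous f) {A B : ℝ}
    (hAB : ∀ x, |f x| ≤ A + B * ∑ k, |x k|) : Integrable f (Measure.pi μ) := by
  refine Integrable.mono' (g := fun x => A + B * ∑ k, |x k|) ?_ hf.aestronglyMeasurable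
    (ae_of_all _ hAB)
  refine (integrable_const A).add (Integrable.const_mul (integrable_finsetSum _ fun k _ => ?_) B)
  exact (integrable_comp_eval (μ := μ) (i := k) (hμ k)).abs

end ProductMeasure

/-- A centred probability law on `ℝ` with variance `v` and third absolute moment at most `κ`. -/
structure CenteredLaw (ν : Measure ℝ) (v κ : ℝ) : Prop where
  prob : IsProbabilityMeasure ν
  integrable_cube : Integrable (fun x => |x| ^ 3) ν
  mean : ∫ x, x ∂ν = 0
  var : ∫ x, x ^ 2 ∂ν = v
  cube : ∫ x, |x| ^ 3 ∂ν ≤ κ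

namespace CenteredLaw

variable {ν : Measure ℝ} {v κ : ℝ}

lemma integrable_sq (h : CenteredLaw ν v κ) : Integrable (fun x => x ^ 2) ν := by
  have := h.prob
  refine Integrable.mono' (g := fun x => 1 + |x| ^ 3) ((integrable_const 1).add h.integrable_cube)
    (by fun_prop) (ae_of_all _ fun x => ?_)
  have hx := abs_nonneg x
  rw [Real.norm_eq_abs, abs_pow]
  nlinarith [sq_nonneg (|x| - 1), mul_nonneg hx (sq_nonneg (|x| - 1))]

lemma integrable_abs (h : CenteredLaw ν v κ) : Integrable (fun x => |x|) ν := by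
  have := h.prob
  refine Integrable.mono' (g := fun x => 1 + x ^ 2) ((integrable_const 1).add h.integrable_sq)
    (by fun_prop) (ae_of_all _ fun x => ?_)
  rw [Real.norm_eq_abs, abs_abs, ← sq_abs]
  nlinarith [sq_nonneg (|x| - 1)]

lemma integrable_id (h : CenteredLaw ν v κ) : Integrable (fun x => x) ν :=
  (integrable_norm_iff (by fun_prop)).1 h.integrable_abs

lemma var_nonneg (h : CenteredLaw ν v κ) : 0 ≤ v := by
  rw [← h.var]
  exact integral_nonneg fun x => sq_nonneg x

lemma var_mul_integral_abs_le (h : CenteredLaw ν v κ) : v * ∫ x, |x| ∂ν ≤ κ := by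
  have := h.prob
  set a := Real.sqrt v
  have ha : a ^ 2 = v := Real.sq_sqrt h.var_nonneg
  have ha0 : 0 ≤ a := Real.sqrt_nonneg v
  have h0 : 0 ≤ ∫ x, (|x| ^ 3 - a * x ^ 2 - a ^ 2 * |x| + a ^ 3) ∂ν := by
    refine integral_nonneg fun x => ?_
    have : |x| ^ 3 - a * x ^ 2 - a ^ 2 * |x| + a ^ 3 = (|x| - a) ^ 2 * (|x| + a) := by
      rw [← sq_abs x]; ring
    simp only [this, Pi.zero_apply]
    positivity
  have i1 := h.integrable_cube
  have i2 := h.integrable_sq.const_mul a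
  have i3 := h.integrable_abs.const_mul (a ^ 2)
  rw [integral_add (integrable_fun_sub (integrable_fun_sub i1 i2) i3) (integrable_const _),
    integral_sub (integrable_fun_sub i1 i2) i3,
    integral_sub i1 i2, integral_const_mul, integral_const_mul, h.var, ha] at h0
  have := h.cube
  simp at h0
  nlinarith

variable {T : Type*} [Fintype T] [Nonempty T]

lemma abs_integral_le_of_abs_le_cube (h : CenteredLaw ν v κ) {f : ℝ → ℝ} {C : ℝ} (hC : 0 ≤ C)
    (hf : ∀ x, |f x| ≤ C * |x| ^ 3) : |∫ x, f x ∂ν| ≤ C * κ := by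
  calc |∫ x, f x ∂ν| ≤ ∫ x, C * |x| ^ 3 ∂ν :=
        norm_integral_le_of_norm_le (f := f) (h.integrable_cube.const_mul C) (ae_of_all _ hf)
    _ = C * ∫ x, |x| ^ 3 ∂ν := integral_const_mul _ _
    _ ≤ C * κ := by gcongr; exact h.cube

lemma continuous_lse_comp {X : Type*} [TopologicalSpace X] {Y : X → T → ℝ}
    (hY : ∀ t, Continuous fun x => Y x t) : Continuous fun x => lse (Y x) := by
  unfold lse
  refine Continuous.log (by fun_prop) fun x => (sum_exp_pos _).ne'

lemma continuous_gavg_comp {X : Type*} [TopologicalSpace X] {Y : X → T → ℝ} (f : T → ℝ)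
    (hY : ∀ t, Continuous fun x => Y x t) : Continuous fun x => gavg (Y x) f := by
  unfold gavg
  exact Continuous.div (by fun_prop) (by fun_prop) fun x => (sum_exp_pos _).ne'

lemma continuous_gvar_comp {X : Type*} [TopologicalSpace X] {Y : X → T → ℝ} (f : T → ℝ)
    (hY : ∀ t, Continuous fun x => Y x t) : Continuous fun x => gvar (Y x) f :=
  (continuous_gavg_comp _ hY).sub ((continuous_gavg_comp _ hY).pow 2)

lemma integrable_lse (h : CenteredLaw ν v κ) (W c : T → ℝ) {M : ℝ} (hc : ∀ t, |c t| ≤ M) :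
    Integrable (fun x => lse fun t => W t + x * c t) ν := by
  have := h.prob
  refine Integrable.mono' (g := fun x => |lse W| + M * |x|)
    ((integrable_const _).add (h.integrable_abs.const_mul M))
    (continuous_lse_comp (by fun_prop)).aestronglyMeasurable (ae_of_all _ fun x => ?_)
  have h1 : |lse (fun t => W t + x * c t) - lse W| ≤ M * |x| := abs_lse_sub_le fun t => by
    rw [add_sub_cancel_left, abs_mul, mul_comm]
    gcongr
    exact hc t
  rw [Real.norm_eq_abs]
  have := abs_add_le (lse W) (lse (fun t => W t + x * c t) - lse W)
  rw [add_sub_cancel] at this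
  linarith

/-- Averaging the log-partition function over one small centred random field only depends on
the variance, up to the third moment. -/
lemma abs_integral_lse_sub_le (h : CenteredLaw ν v κ) (W c : T → ℝ) {M : ℝ}
    (hc : ∀ t, |c t| ≤ M) :
    |∫ x, lse (fun t => W t + x * c t) ∂ν - (lse W + v / 2 * gvar W c)| ≤ 6 * M ^ 3 * κ := by
  have := h.prob
  have hM : 0 ≤ M := (abs_nonneg _).trans (hc (Classical.arbitrary T))
  have key := h.abs_integral_le_of_abs_le_cube (by positivity)
    (fun x => abs_lse_add_mul_sub_le W c hc x)
  have i1 := h.integrable_lse W c hc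
  have i2 := h.integrable_id.mul_const (gavg W c)
  have i3 := (h.integrable_sq.div_const 2).mul_const (gvar W c)
  rw [integral_sub (integrable_fun_sub (integrable_fun_sub i1 (integrable_const _)) i2) i3,
    integral_sub (integrable_fun_sub i1 (integrable_const _)) i2,
    integral_sub i1 (integrable_const _),
    integral_mul_const, integral_mul_const, integral_div, h.mean, h.var] at key
  convert key using 2
  simp
  ring

/-- Approximate integration by parts in one coordinate. -/
lemma abs_integral_mul_gavg_sub_le (h : CenteredLaw ν v κ) (W c : T → ℝ) {M : ℝ}
    (hc : ∀ t, |c t| ≤ M) :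
    |∫ x, x * gavg (fun t => W t + x * c t) c ∂ν
      - ∫ x, v * gvar (fun t => W t + x * c t) c ∂ν| ≤ 12 * M ^ 3 * κ := by
  have := h.prob
  have hM : 0 ≤ M := (abs_nonneg _).trans (hc (Classical.arbitrary T))
  have hbd : ∀ x, |gavg (fun t => W t + x * c t) c| ≤ M := fun x => abs_gavg_le _ hc
  have hgv : ∀ x, |gvar (fun t => W t + x * c t) c| ≤ |gvar W c| + 6 * M ^ 3 * |x| := fun x => by
    have h1 := abs_gvar_add_mul_sub_le W c hc x
    have h2 := abs_add_le (gvar W c) (gvar (fun t => W t + x * c t) c - gvar W c)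
    rw [add_sub_cancel] at h2
    linarith
  have i1 : Integrable (fun x => x * gavg (fun t => W t + x * c t) c) ν := by
    refine Integrable.mono' (g := fun x => M * |x|) (h.integrable_abs.const_mul M)
      (continuous_id.mul (continuous_gavg_comp _ (by fun_prop))).aestronglyMeasurable
      (ae_of_all _ fun x => ?_)
    rw [Real.norm_eq_abs, abs_mul, mul_comm]
    gcongr
    exact hbd x
  have i2 : Integrable (fun x => gvar (fun t => W t + x * c t) c) ν := by
    refine Integrable.mono' (g := fun x => |gvar W c| + 6 * M ^ 3 * |x|)
      ((integrable_const _).add (h.integrable_abs.const_mul _))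
      (continuous_gvar_comp _ (by fun_prop)).aestronglyMeasurable (ae_of_all _ hgv)
  have key1 : |∫ x, x * gavg (fun t => W t + x * c t) c ∂ν - v * gvar W c| ≤ 6 * M ^ 3 * κ := by
    have key := h.abs_integral_le_of_abs_le_cube (C := 6 * M ^ 3) (by positivity)
      (f := fun x => x * gavg (fun t => W t + x * c t) c - x * gavg W c - x ^ 2 * gvar W c)
      (fun x => by
        have h1 := abs_gavg_add_mul_sub_le W c hc x
        calc _ = |x * (gavg (fun t => W t + x * c t) c - gavg W c - x * gvar W c)| := by
              congr 1; ring
          _ = |x| * |gavg (fun t => W t + x * c t) c - gavg W c - x * gvar W c| := abs_mul _ _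
          _ ≤ |x| * (6 * M ^ 3 * |x| ^ 2) := by gcongr
          _ = _ := by ring)
    have j2 := h.integrable_id.mul_const (gavg W c)
    have j3 := h.integrable_sq.mul_const (gvar W c)
    rw [integral_sub (integrable_fun_sub i1 j2) j3, integral_sub i1 j2,
      integral_mul_const, integral_mul_const, h.mean, h.var] at key
    simpa using key
  have key2 : |∫ x, gvar (fun t => W t + x * c t) c ∂ν - gvar W c|
      ≤ 6 * M ^ 3 * ∫ x, |x| ∂ν := by
    have := norm_integral_le_of_norm_le (h.integrable_abs.const_mul (6 * M ^ 3))
      (f := fun x => gvar (fun t => W t + x * c t) c - gvar W c)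
      (ae_of_all ν fun x => abs_gvar_add_mul_sub_le W c hc x)
    rw [integral_sub i2 (integrable_const _), integral_const_mul] at this
    simpa using this
  have h3 := h.var_mul_integral_abs_le
  have hv := h.var_nonneg
  rw [integral_const_mul]
  calc _ = |(∫ x, x * gavg (fun t => W t + x * c t) c ∂ν - v * gvar W c)
        - v * (∫ x, gvar (fun t => W t + x * c t) c ∂ν - gvar W c)| := by congr 1; ring
    _ ≤ _ := abs_sub _ _
    _ ≤ 6 * M ^ 3 * κ + v * (6 * M ^ 3 * ∫ x, |x| ∂ν) := by
        rw [abs_mul, abs_of_nonneg hv]; gcongr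
    _ = 6 * M ^ 3 * κ + 6 * M ^ 3 * (v * ∫ x, |x| ∂ν) := by ring
    _ ≤ 6 * M ^ 3 * κ + 6 * M ^ 3 * κ := by gcongr
    _ = _ := by ring

end CenteredLaw

section RandomField

variable {ι T : Type*} [Fintype ι]

/-- The energy profile `∑ₖ xₖ cₖ` with disorder `x` and interactions `c`. -/
def field (c : ι → T → ℝ) (x : ι → ℝ) (t : T) : ℝ := ∑ k, x k * c k t

lemma continuous_field (c : ι → T → ℝ) (t : T) : Continuous fun x => field c x t := by
  unfold field
  fun_prop

lemma field_update [DecidableEq ι] (c : ι → T → ℝ) (x : ι → ℝ) (k : ι) (y : ℝ) (t : T) :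
    field c (Function.update x k y) t = field c (Function.update x k 0) t + y * c k t := by
  unfold field
  rw [← Finset.add_sum_erase Finset.univ _ (Finset.mem_univ k),
    ← Finset.add_sum_erase Finset.univ (fun l => Function.update x k 0 l * c l t)
      (Finset.mem_univ k)]
  simp only [Function.update_self, zero_mul, zero_add]
  rw [add_comm]
  congr 1
  refine Finset.sum_congr rfl fun l hl => ?_
  simp [Finset.ne_of_mem_erase hl]

lemma field_add (c : ι → T → ℝ) (x y : ι → ℝ) (t : T) :
    field c (x + y) t = field c x t + field c y t := by
  simp [field, add_mul, Finset.sum_add_distrib]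

lemma abs_field_le {c : ι → T → ℝ} {M : ℝ} (hc : ∀ k t, |c k t| ≤ M) (x : ι → ℝ) (t : T) :
    |field c x t| ≤ M * ∑ k, |x k| := by
  unfold field
  refine (Finset.abs_sum_le_sum_abs _ _).trans ?_
  rw [Finset.mul_sum]
  refine Finset.sum_le_sum fun k _ => ?_
  rw [abs_mul, mul_comm]
  gcongr
  exact hc k t

variable [Fintype T] [Nonempty T]

lemma abs_lse_add_field_le {c : ι → T → ℝ} {M : ℝ} (hc : ∀ k t, |c k t| ≤ M) (W : T → ℝ)
    (x : ι → ℝ) : |lse (fun t => W t + field c x t)| ≤ |lse W| + M * ∑ k, |x k| := by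
  have h1 : |lse (fun t => W t + field c x t) - lse W| ≤ M * ∑ k, |x k| :=
    abs_lse_sub_le fun t => by
      rw [add_sub_cancel_left]
      exact abs_field_le hc x t
  have h2 := abs_add_le (lse W) (lse (fun t => W t + field c x t) - lse W)
  rw [add_sub_cancel] at h2
  linarith

lemma integrable_lse_add_field {μ : ι → Measure ℝ} [∀ k, IsProbabilityMeasure (μ k)]
    (hμ : ∀ k, Integrable (fun x => x) (μ k)) {c : ι → T → ℝ} {M : ℝ} (hc : ∀ k t, |c k t| ≤ M)
    (W : T → ℝ) : Integrable (fun x => lse fun t => W t + field c x t) (Measure.pi μ) :=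
  integrable_pi_of_linear_growth hμ
    (CenteredLaw.continuous_lse_comp fun t => continuous_const.add (continuous_field c t))
    (abs_lse_add_field_le hc W)

lemma integrable_lse_field {μ : ι → Measure ℝ} [∀ k, IsProbabilityMeasure (μ k)]
    (hμ : ∀ k, Integrable (fun x => x) (μ k)) {c : ι → T → ℝ} {M : ℝ} (hc : ∀ k t, |c k t| ≤ M) :
    Integrable (fun x => lse (field c x)) (Measure.pi μ) := by
  simpa using integrable_lse_add_field hμ hc (fun _ => 0)

/-- Universality of the mean log-partition function: it depends on the law of the disorder only
through its variance, up to third moments. -/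
theorem abs_integral_lse_field_sub_le {ν ν' : Measure ℝ} {v κ κ' : ℝ} (hν : CenteredLaw ν v κ)
    (hν' : CenteredLaw ν' v κ') {c : ι → T → ℝ} {M : ℝ} (hc : ∀ k t, |c k t| ≤ M) :
    |∫ x, lse (field c x) ∂(Measure.pi fun _ : ι => ν')
      - ∫ x, lse (field c x) ∂(Measure.pi fun _ : ι => ν)|
      ≤ Fintype.card ι * (6 * M ^ 3 * (κ + κ')) := by
  classical
  have := hν.prob
  have := hν'.prob
  let hyb : Finset ι → ι → Measure ℝ := fun J k => if k ∈ J then ν' else ν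
  have hprob : ∀ J k, IsProbabilityMeasure (hyb J k) := fun J k => by
    dsimp only [hyb]; split_ifs <;> assumption
  have hint : ∀ J k, Integrable (fun x => x) (hyb J k) := fun J k => by
    dsimp only [hyb]
    split_ifs
    exacts [hν'.integrable_id, hν.integrable_id]
  have key : ∀ J : Finset ι, |∫ x, lse (field c x) ∂(Measure.pi (hyb J))
      - ∫ x, lse (field c x) ∂(Measure.pi (hyb ∅))| ≤ J.card * (6 * M ^ 3 * (κ + κ')) := by
    intro J
    induction J using Finset.induction_on with
    | empty => simp
    | insert k J hk ih =>
      have e1 : hyb (insert k J) = Function.update (hyb J) k ν' := by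
        funext l
        rcases eq_or_ne l k with rfl | hl
        · simp [hyb]
        · simp [hyb, hl]
      have e2 : hyb J = Function.update (hyb J) k ν := by
        funext l
        rcases eq_or_ne l k with rfl | hl
        · simp [hyb, hk]
        · simp [hl]
      have i1 := integrable_lse_field (hint (insert k J)) hc
      have i2 := integrable_lse_field (hint J) hc
      have step : |∫ x, lse (field c x) ∂(Measure.pi (hyb (insert k J)))
          - ∫ x, lse (field c x) ∂(Measure.pi (hyb J))| ≤ 6 * M ^ 3 * (κ + κ') := by
        rw [e1] at i1 ⊢
        rw [e2] at i2
        conv_lhs => rw [e2, Function.update_idem]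
        refine abs_integral_pi_update_sub_le i1 i2 fun x => ?_
        obtain ⟨W, e⟩ : ∃ W : T → ℝ, ∀ y, field c (Function.update x k y)
            = fun t => W t + y * c k t := ⟨_, fun y => funext (field_update c x k y)⟩
        have h1 := hν.abs_integral_lse_sub_le W (c k) (hc k)
        have h2 := hν'.abs_integral_lse_sub_le W (c k) (hc k)
        simp only [e]
        rw [abs_le] at *
        constructor <;> linarith
      rw [Finset.card_insert_of_notMem hk]
      push_cast
      have := abs_add_le
        (∫ x, lse (field c x) ∂(Measure.pi (hyb (insert k J)))
          - ∫ x, lse (field c x) ∂(Measure.pi (hyb J)))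
        (∫ x, lse (field c x) ∂(Measure.pi (hyb J))
          - ∫ x, lse (field c x) ∂(Measure.pi (hyb ∅)))
      rw [sub_add_sub_cancel] at this
      linarith
  have h := key Finset.univ
  simpa [hyb] using h

lemma abs_gvar_le (Y : T → ℝ) {f : T → ℝ} {M : ℝ} (hf : ∀ t, |f t| ≤ M) :
    |gvar Y f| ≤ 2 * M ^ 2 := by
  have h1 : |gavg Y f| ≤ M := abs_gavg_le Y hf
  have h2 : |gavg Y (fun t => f t ^ 2)| ≤ M ^ 2 := abs_gavg_le Y fun t => by
    rw [abs_pow]; gcongr; exact hf t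
  have h3 : |gavg Y f ^ 2| ≤ M ^ 2 := by rw [abs_pow]; gcongr
  unfold gvar
  rw [abs_le] at *
  constructor <;> linarith

/-- Approximate integration by parts for the mean energy. -/
theorem abs_integral_gavg_field_sub_le {ν : Measure ℝ} {v κ : ℝ} (hν : CenteredLaw ν v κ)
    {c : ι → T → ℝ} {M : ℝ} (hc : ∀ k t, |c k t| ≤ M) :
    |∫ x, gavg (field c x) (field c x) ∂(Measure.pi fun _ : ι => ν)
      - ∫ x, ∑ k, v * gvar (field c x) (c k) ∂(Measure.pi fun _ : ι => ν)|
      ≤ Fintype.card ι * (12 * M ^ 3 * κ) := by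
  classical
  have := hν.prob
  have hid : ι → Integrable (fun x => x) ν := fun _ => hν.integrable_id
  have hsum : ∀ x, gavg (field c x) (field c x) = ∑ k, x k * gavg (field c x) (c k) := fun x => by
    conv_lhs => rw [show field c x = fun t => ∑ k, x k * c k t from rfl]
    rw [gavg_sum]
    exact Finset.sum_congr rfl fun k _ => gavg_const_mul _ _ _
  have i1 : ∀ k, Integrable (fun x : ι → ℝ => x k * gavg (field c x) (c k))
      (Measure.pi fun _ : ι => ν) := fun k => by
    have hM : 0 ≤ M := (abs_nonneg _).trans (hc k (Classical.arbitrary T))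
    refine integrable_pi_of_linear_growth hid
      ((continuous_apply k).mul (CenteredLaw.continuous_gavg_comp _ (continuous_field c)))
      (A := 0) (B := M) fun x => ?_
    rw [abs_mul, zero_add, mul_comm]
    have h1 : |x k| ≤ ∑ k, |x k| :=
      Finset.single_le_sum (f := fun k => |x k|) (fun _ _ => abs_nonneg _) (Finset.mem_univ k)
    have h2 := abs_gavg_le (field c x) (hc k)
    gcongr
  have i2 : ∀ k, Integrable (fun x : ι → ℝ => v * gvar (field c x) (c k))
      (Measure.pi fun _ : ι => ν) := fun k => by
    refine Integrable.const_mul (integrable_pi_of_linear_growth hid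
      (CenteredLaw.continuous_gvar_comp _ (continuous_field c)) (A := 2 * M ^ 2) (B := 0)
      fun x => ?_) v
    simpa using abs_gvar_le (field c x) (hc k)
  simp only [hsum]
  rw [integral_finsetSum _ fun k _ => i1 k, integral_finsetSum _ fun k _ => i2 k,
    ← Finset.sum_sub_distrib]
  refine (Finset.abs_sum_le_sum_abs _ _).trans ?_
  rw [← nsmul_eq_mul, ← Finset.card_univ, ← Finset.sum_const]
  refine Finset.sum_le_sum fun k _ => ?_
  have e2 : (fun _ : ι => ν) = Function.update (fun _ : ι => ν) k ν := by simp
  have j1 := i1 k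
  have j2 := i2 k
  rw [e2] at j1 j2
  have e1 : ∀ f : (ι → ℝ) → ℝ, ∫ x, f x ∂(Measure.pi fun _ : ι => ν)
      = ∫ x, f x ∂(Measure.pi (Function.update (fun _ : ι => ν) k ν)) := fun f => by rw [← e2]
  rw [e1, e1]
  refine abs_integral_pi_update_sub_le j1 j2 fun x => ?_
  obtain ⟨W, e⟩ : ∃ W : T → ℝ, ∀ y, field c (Function.update x k y)
      = fun t => W t + y * c k t := ⟨_, fun y => funext (field_update c x k y)⟩
  have h1 := hν.abs_integral_mul_gavg_sub_le W (c k) (hc k)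
  simpa only [e, Function.update_self] using h1

end RandomField

section GaussianField

/-- The third absolute moment of the standard Gaussian law. -/
noncomputable def gaussCube : ℝ := ∫ x, |x| ^ 3 ∂(gaussianReal 0 1)

lemma gaussCube_nonneg : 0 ≤ gaussCube := integral_nonneg fun x => by positivity

lemma centeredLaw_gaussianReal (v : NNReal) :
    CenteredLaw (gaussianReal 0 v) v (gaussCube * Real.sqrt v ^ 3) where
  prob := inferInstance
  integrable_cube := by
    simpa using (memLp_id_gaussianReal (μ := 0) (v := v) 3).integrable_norm_pow (p := 3) (by simp)
  mean := by simp
  var := by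
    have h := variance_id_gaussianReal (μ := 0) (v := v)
    rwa [variance_of_integral_eq_zero (by fun_prop) (by simp)] at h
  cube := by
    have h := gaussianReal_map_const_mul (μ := 0) (v := 1) (Real.sqrt v)
    have e : NNReal.mk (Real.sqrt v ^ 2) (sq_nonneg _) * 1 = v := by
      ext
      simp
    rw [e, mul_zero] at h
    rw [← h, integral_map (by fun_prop) (by fun_prop)]
    simp only [abs_mul, mul_pow, abs_of_nonneg (Real.sqrt_nonneg (v : ℝ))]
    rw [integral_const_mul, gaussCube, mul_comm]

variable {ι T : Type*} [Fintype ι]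

/-- The law of independent centred Gaussians with variances `w`. -/
noncomputable def gaussPi (w : ι → NNReal) : Measure (ι → ℝ) :=
  Measure.pi fun k => gaussianReal 0 (w k)

instance (w : ι → NNReal) : IsProbabilityMeasure (gaussPi w) := by
  unfold gaussPi; infer_instance

lemma map_add_gaussPi (w w' : ι → NNReal) :
    ((gaussPi w).prod (gaussPi w')).map (fun p => p.1 + p.2) = gaussPi (w + w') := by
  have h := (measurePreserving_arrowProdEquivProdArrow ℝ ℝ ι (fun k => gaussianReal 0 (w k))
    (fun k => gaussianReal 0 (w' k))).map_eq
  unfold gaussPi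
  rw [← h, Measure.map_map (by fun_prop) (MeasurableEquiv.measurable _)]
  have e : ((fun p : (ι → ℝ) × (ι → ℝ) => p.1 + p.2) ∘
      (MeasurableEquiv.arrowProdEquivProdArrow ℝ ℝ ι)) = fun x k => (x k).1 + (x k).2 := by
    funext x k
    rfl
  have hconv : ∀ k, ((gaussianReal 0 (w k)).prod (gaussianReal 0 (w' k))).map
      (fun p => p.1 + p.2) = gaussianReal 0 (w k + w' k) := fun k => by
    have := gaussianReal_conv_gaussianReal (m₁ := 0) (m₂ := 0) (v₁ := w k) (v₂ := w' k)
    rwa [add_zero] at this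
  rw [e]
  have : ∀ k, SigmaFinite (((gaussianReal 0 (w k)).prod (gaussianReal 0 (w' k))).map
      (fun p => p.1 + p.2)) := fun k => by rw [hconv]; infer_instance
  rw [Measure.pi_map_pi (f := fun _ (p : ℝ × ℝ) => p.1 + p.2) (fun k => by fun_prop)]
  simp only [hconv, Pi.add_apply]

lemma integrable_eval_gaussPi (w : ι → NNReal) (k : ι) :
    Integrable (fun x => x k) (gaussPi w) :=
  integrable_comp_eval (μ := fun k => gaussianReal 0 (w k)) (i := k)
    (centeredLaw_gaussianReal (w k)).integrable_id

lemma integral_linear_gaussPi (w : ι → NNReal) (a : ι → ℝ) :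
    ∫ x, ∑ k, x k * a k ∂(gaussPi w) = 0 := by
  rw [integral_finsetSum _ fun k _ => (integrable_eval_gaussPi w k).mul_const _]
  refine Finset.sum_eq_zero fun k _ => ?_
  rw [integral_mul_const]
  have : ∫ x, x k ∂(gaussPi w) = ∫ y, y ∂(gaussianReal 0 (w k)) :=
    integral_comp_eval (μ := fun k => gaussianReal 0 (w k)) (i := k) (f := fun y : ℝ => y)
      (by fun_prop)
  rw [this, (centeredLaw_gaussianReal (w k)).mean, zero_mul]

lemma memLp_linear_gaussPi (w : ι → NNReal) (a : ι → ℝ) :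
    MemLp (fun x => ∑ k, x k * a k) 2 (gaussPi w) := by
  refine memLp_finsetSum _ fun k _ => ?_
  have h1 : MemLp (fun y : ℝ => y * a k) 2 (gaussianReal 0 (w k)) :=
    (memLp_id_gaussianReal (μ := 0) (v := w k) 2).mul_const (a k)
  exact h1.comp_measurePreserving
    (measurePreserving_eval (μ := fun k => gaussianReal 0 (w k)) k)

lemma integral_linear_sq_gaussPi (w : ι → NNReal) (a : ι → ℝ) :
    ∫ x, (∑ k, x k * a k) ^ 2 ∂(gaussPi w) = ∑ k, w k * a k ^ 2 := by
  rw [← variance_of_integral_eq_zero (memLp_linear_gaussPi w a).aemeasurable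
    (integral_linear_gaussPi w a)]
  have h := variance_sum_pi (μ := fun k => gaussianReal 0 (w k)) (X := fun k y => y * a k)
    fun k => (memLp_id_gaussianReal (μ := 0) (v := w k) 2).mul_const (a k)
  have e : (∑ k, fun x : ι → ℝ => x k * a k) = fun x => ∑ k, x k * a k := by
    funext x
    simp
  rw [e] at h
  refine h.trans (Finset.sum_congr rfl fun k _ => ?_)
  rw [variance_mul_const]
  have := variance_id_gaussianReal (μ := 0) (v := w k)
  exact congrArg (· * a k ^ 2) this

lemma integral_cube_gaussPi_le (w : ι → NNReal) :
    Integrable (fun x : ι → ℝ => (∑ k, |x k|) ^ 3) (gaussPi w) ∧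
    ∫ x, (∑ k, |x k|) ^ 3 ∂(gaussPi w)
      ≤ (Fintype.card ι : ℝ) ^ 2 * (gaussCube * ∑ k, Real.sqrt (w k) ^ 3) := by
  have i1 : ∀ k, Integrable (fun x : ι → ℝ => |x k| ^ 3) (gaussPi w) := fun k =>
    integrable_comp_eval (μ := fun k => gaussianReal 0 (w k)) (i := k)
      (centeredLaw_gaussianReal (w k)).integrable_cube
  have i2 := (integrable_finsetSum Finset.univ fun k _ => i1 k).const_mul
    ((Fintype.card ι : ℝ) ^ 2)
  have hle : ∀ x : ι → ℝ, (∑ k, |x k|) ^ 3 ≤ (Fintype.card ι : ℝ) ^ 2 * ∑ k, |x k| ^ 3 := by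
    intro x
    have h := pow_sum_div_card_le_sum_pow (s := Finset.univ) (f := fun k => |x k|)
      (fun k _ => abs_nonneg _) 2
    rcases isEmpty_or_nonempty ι with hι | hι
    · simp
    · rw [div_le_iff₀ (by simp; positivity)] at h
      rw [mul_comm]
      simpa using h
  have i3 : Integrable (fun x : ι → ℝ => (∑ k, |x k|) ^ 3) (gaussPi w) := by
    refine i2.mono'
      (by have : Continuous fun x : ι → ℝ => (∑ k, |x k|) ^ 3 := by fun_prop
          exact this.aestronglyMeasurable) (ae_of_all _ fun x => ?_)
    rw [Real.norm_eq_abs, abs_of_nonneg (by positivity)]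
    exact hle x
  refine ⟨i3, (integral_mono i3 i2 hle).trans ?_⟩
  rw [integral_const_mul, integral_finsetSum _ fun k _ => i1 k, Finset.mul_sum (a := gaussCube)]
  refine mul_le_mul_of_nonneg_left (Finset.sum_le_sum fun k _ => ?_)
    (sq_nonneg (Fintype.card ι : ℝ))
  have : ∫ x, |x k| ^ 3 ∂(gaussPi w) = ∫ y, |y| ^ 3 ∂(gaussianReal 0 (w k)) :=
    integral_comp_eval (μ := fun k => gaussianReal 0 (w k)) (i := k)
      (f := fun y : ℝ => |y| ^ 3) (by fun_prop)
  rw [this]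
  exact (centeredLaw_gaussianReal (w k)).cube

variable [Fintype T] [Nonempty T]

lemma integrable_lse_add_field_gaussPi (w : ι → NNReal) {c : ι → T → ℝ} {M : ℝ}
    (hc : ∀ k t, |c k t| ≤ M) (W : T → ℝ) :
    Integrable (fun x => lse fun t => W t + field c x t) (gaussPi w) :=
  integrable_lse_add_field (fun k => (centeredLaw_gaussianReal (w k)).integrable_id) hc W

lemma integrable_lse_field_gaussPi (w : ι → NNReal) {c : ι → T → ℝ} {M : ℝ}
    (hc : ∀ k t, |c k t| ≤ M) : Integrable (fun x => lse (field c x)) (gaussPi w) :=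
  integrable_lse_field (fun k => (centeredLaw_gaussianReal (w k)).integrable_id) hc

/-- Second-order expansion of the mean log-partition function in a small Gaussian field. -/
lemma abs_integral_lse_add_field_sub_le (w : ι → NNReal) {c : ι → T → ℝ} {M : ℝ} (hM : 0 ≤ M)
    (hc : ∀ k t, |c k t| ≤ M) (W : T → ℝ) :
    |∫ x, lse (fun t => W t + field c x t) ∂(gaussPi w)
      - (lse W + (∑ k, w k * gvar W (c k)) / 2)|
      ≤ 6 * M ^ 3 *
        ((Fintype.card ι : ℝ) ^ 2 * (gaussCube * ∑ k, Real.sqrt (w k) ^ 3)) := by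
  have hpt : ∀ x, |lse (fun t => W t + field c x t) - lse W - gavg W (field c x)
      - gvar W (field c x) / 2| ≤ 6 * M ^ 3 * (∑ k, |x k|) ^ 3 := fun x => by
    have h := abs_lse_add_mul_sub_le W (field c x) (abs_field_le hc x) 1
    simp only [one_mul, abs_one, one_pow, mul_one] at h
    rw [one_div_mul_eq_div, mul_pow, ← mul_assoc] at h
    exact h
  have hlin : ∀ x, gavg W (field c x) = ∑ k, x k * gavg W (c k) := fun x => by
    rw [show field c x = fun t => ∑ k, x k * c k t from rfl, gavg_sum]
    exact Finset.sum_congr rfl fun k _ => gavg_const_mul _ _ _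
  have hi := integral_cube_gaussPi_le w
  have i0 := integrable_lse_add_field_gaussPi w hc W
  have i1 : Integrable (fun x => gavg W (field c x)) (gaussPi w) := by
    simp only [hlin]
    exact (memLp_linear_gaussPi w _).integrable (by norm_num)
  have e1 : ∫ x, gavg W (field c x) ∂(gaussPi w) = 0 := by
    simp only [hlin]
    exact integral_linear_gaussPi w _
  have j1 : Integrable (fun x => gavg W (field c x) ^ 2) (gaussPi w) := by
    simp only [hlin]
    exact (memLp_linear_gaussPi w _).integrable_sq
  have j2 : ∀ t, Integrable (fun x => field c x t ^ 2 * Real.exp (W t)) (gaussPi w) := fun t =>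
    (memLp_linear_gaussPi w (fun k => c k t)).integrable_sq.mul_const _
  have j3 : Integrable (fun x => gavg W (fun t => field c x t ^ 2)) (gaussPi w) :=
    (integrable_finsetSum _ fun t _ => j2 t).div_const _
  have i2 : Integrable (fun x => gvar W (field c x)) (gaussPi w) := j3.sub j1
  have e2 : ∫ x, gvar W (field c x) ∂(gaussPi w) = ∑ k, w k * gvar W (c k) := by
    unfold gvar
    rw [integral_sub j3 j1]
    have e3 : ∫ x, gavg W (field c x) ^ 2 ∂(gaussPi w) = ∑ k, w k * gavg W (c k) ^ 2 := by
      simp only [hlin]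
      exact integral_linear_sq_gaussPi w _
    have e4 : ∫ x, gavg W (fun t => field c x t ^ 2) ∂(gaussPi w)
        = ∑ k, w k * gavg W (fun t => c k t ^ 2) := by
      conv_rhs => enter [2, k]; rw [← gavg_const_mul]
      rw [← gavg_sum]
      unfold gavg
      rw [integral_div, integral_finsetSum _ fun t _ => j2 t]
      congr 1
      refine Finset.sum_congr rfl fun t _ => ?_
      rw [integral_mul_const]
      congr 1
      exact integral_linear_sq_gaussPi w _
    rw [e3, e4, ← Finset.sum_sub_distrib]
    exact Finset.sum_congr rfl fun k _ => by ring
  have key := norm_integral_le_of_norm_le (f := fun x => lse (fun t => W t + field c x t) - lse W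
    - gavg W (field c x) - gvar W (field c x) / 2) (hi.1.const_mul (6 * M ^ 3)) (ae_of_all _ hpt)
  rw [integral_sub (integrable_fun_sub (integrable_fun_sub i0 (integrable_const _)) i1)
    (i2.div_const 2), integral_sub (integrable_fun_sub i0 (integrable_const _)) i1,
    integral_sub i0 (integrable_const _), integral_div, e1, e2, integral_const_mul] at key
  refine le_trans (le_of_eq ?_) (key.trans ?_)
  · rw [Real.norm_eq_abs]
    congr 1
    simp
    ring
  · have := hi.2
    gcongr

lemma integral_lse_field_gaussPi_add (w w' : ι → NNReal) {c : ι → T → ℝ} {M : ℝ}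
    (hc : ∀ k t, |c k t| ≤ M) :
    Integrable (fun x => ∫ y, lse (fun t => field c x t + field c y t) ∂(gaussPi w'))
      (gaussPi w) ∧
    ∫ x, lse (field c x) ∂(gaussPi (w + w'))
      = ∫ x, ∫ y, lse (fun t => field c x t + field c y t) ∂(gaussPi w') ∂(gaussPi w) := by
  have h := integrable_lse_field_gaussPi (w + w') hc
  have e : ∀ p : (ι → ℝ) × (ι → ℝ), lse (field c (p.1 + p.2))
      = lse (fun t => field c p.1 t + field c p.2 t) := fun p => by
    congr 1
    exact funext (field_add c p.1 p.2)
  have hi : Integrable (fun p : (ι → ℝ) × (ι → ℝ) =>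
      lse (fun t => field c p.1 t + field c p.2 t)) ((gaussPi w).prod (gaussPi w')) := by
    rw [← map_add_gaussPi] at h
    simpa only [Function.comp_def, e] using h.comp_measurable (by fun_prop)
  refine ⟨hi.integral_prod_left, ?_⟩
  rw [← integral_prod (fun p : (ι → ℝ) × (ι → ℝ) =>
      lse (fun t => field c p.1 t + field c p.2 t)) hi, ← map_add_gaussPi,
    integral_map (by fun_prop) (by rw [map_add_gaussPi]; exact h.aestronglyMeasurable)]
  simp only [e]

lemma sum_mul_gavg_sq_le (W : T → ℝ) {c : ι → T → ℝ} {a : ι → ℝ} {C : ℝ}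
    (h : ∀ t u, ∑ k, a k * (c k t * c k u) ≤ C) : ∑ k, a k * gavg W (c k) ^ 2 ≤ C := by
  have e : ∑ k, a k * gavg W (c k) ^ 2
      = gavg W (fun t => gavg W (fun u => ∑ k, a k * (c k t * c k u))) := by
    simp only [gavg_sum, gavg_const_mul]
    refine Finset.sum_congr rfl fun k _ => ?_
    have : (fun t => c k t * gavg W (c k)) = fun t => gavg W (c k) * c k t := by
      funext t; ring
    rw [this, gavg_const_mul]
    ring
  rw [e, ← gavg_const W C]
  refine gavg_mono W fun t => ?_
  conv_rhs => rw [← gavg_const W C]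
  exact gavg_mono W fun u => h t u

/-- Gaussian comparison: the mean log-partition function increases by at least half the excess of
the increase of the variances over the increase of the covariances. -/
theorem le_integral_lse_field_gaussPi_sub (w₀ w₁ : ι → NNReal) {c : ι → T → ℝ} {M D C : ℝ}
    (hc : ∀ k t, |c k t| ≤ M)
    (hD : ∀ t, D ≤ ∑ k, ((w₁ k : ℝ) - w₀ k) * c k t ^ 2)
    (hC : ∀ t u, ∑ k, ((w₁ k : ℝ) - w₀ k) * (c k t * c k u) ≤ C) :
    (D - C) / 2 ≤ ∫ x, lse (field c x) ∂(gaussPi w₁) - ∫ x, lse (field c x) ∂(gaussPi w₀) := by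
  wlog hM : 0 ≤ M generalizing M
  · exact this (M := |M|) (fun k t => (hc k t).trans (le_abs_self M)) (abs_nonneg M)
  set Φ : (ι → NNReal) → ℝ := fun w => ∫ x, lse (field c x) ∂(gaussPi w) with hΦ
  have hgv : ∀ W, D - C ≤ ∑ k, ((w₁ k : ℝ) - w₀ k) * gvar W (c k) := fun W => by
    have h1 := sum_mul_gavg_sq_le W hC
    have h2 : D ≤ ∑ k, ((w₁ k : ℝ) - w₀ k) * gavg W (fun t => c k t ^ 2) := by
      conv_rhs => enter [2, k]; rw [← gavg_const_mul]
      rw [← gavg_sum, ← gavg_const W D]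
      exact gavg_mono W hD
    unfold gvar
    simp only [mul_sub, Finset.sum_sub_distrib]
    linarith
  set B : (ι → NNReal) → ℝ := fun w => 6 * M ^ 3 *
    ((Fintype.card ι : ℝ) ^ 2 * (gaussCube * ∑ k, Real.sqrt (w k) ^ 3)) with hB
  have hstep : ∀ (u : ι → NNReal) (e : NNReal),
      Φ (u + e • w₀) + ((e : ℝ) * ((D - C) / 2) - (B (e • w₀) + B (e • w₁)))
        ≤ Φ (u + e • w₁) := by
    intro u e
    obtain ⟨i0, e0⟩ := integral_lse_field_gaussPi_add u (e • w₀) hc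
    obtain ⟨i1, e1⟩ := integral_lse_field_gaussPi_add u (e • w₁) hc
    simp only [hΦ]
    rw [e0, e1]
    have hconst : ∀ a : ℝ, a = ∫ _, a ∂(gaussPi u) := fun a => by simp
    rw [hconst ((e : ℝ) * ((D - C) / 2) - (B (e • w₀) + B (e • w₁))),
      ← integral_add i0 (integrable_const _)]
    refine integral_mono (i0.add (integrable_const _)) i1 fun x => ?_
    have h0 := abs_integral_lse_add_field_sub_le (e • w₀) hM hc (field c x)
    have h1 := abs_integral_lse_add_field_sub_le (e • w₁) hM hc (field c x)
    have h2 := mul_le_mul_of_nonneg_left (hgv (field c x)) e.2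
    have h3 : (e : ℝ) * ∑ k, ((w₁ k : ℝ) - w₀ k) * gvar (field c x) (c k)
        = ∑ k, ((e • w₁) k : ℝ) * gvar (field c x) (c k)
          - ∑ k, ((e • w₀) k : ℝ) * gvar (field c x) (c k) := by
      rw [Finset.mul_sum, ← Finset.sum_sub_distrib]
      refine Finset.sum_congr rfl fun k _ => ?_
      simp only [Pi.smul_apply, smul_eq_mul, NNReal.coe_mul]
      ring
    have h4 : (e : ℝ) * (D - C) ≤ _ := h2.trans_eq h3
    rw [abs_le] at h0 h1
    simp only [hB]
    linarith [h0.2, h1.1]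
  have hBscale : ∀ (e : NNReal) (w : ι → NNReal), B (e • w) = Real.sqrt e ^ 3 * B w := by
    intro e w
    simp only [hB, Pi.smul_apply, smul_eq_mul, NNReal.coe_mul,
      Real.sqrt_mul (NNReal.coe_nonneg e), mul_pow]
    rw [← Finset.mul_sum]
    ring
  have htel : ∀ (e : NNReal) (m b : ℕ),
      Φ ((m : NNReal) • e • w₀ + (b : NNReal) • e • w₁)
        + m * ((e : ℝ) * ((D - C) / 2) - (B (e • w₀) + B (e • w₁)))
      ≤ Φ (((b + m : ℕ) : NNReal) • e • w₁) := by
    intro e m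
    induction m with
    | zero => intro b; simp
    | succ m ih =>
      intro b
      have h1 := hstep ((m : NNReal) • e • w₀ + (b : NNReal) • e • w₁) e
      have h2 := ih (b + 1)
      rw [show (m : NNReal) • e • w₀ + (b : NNReal) • e • w₁ + e • w₁
        = (m : NNReal) • e • w₀ + ((b + 1 : ℕ) : NNReal) • e • w₁ by
          push_cast; rw [add_smul, one_smul, add_assoc],
        show (m : NNReal) • e • w₀ + (b : NNReal) • e • w₁ + e • w₀
        = ((m + 1 : ℕ) : NNReal) • e • w₀ + (b : NNReal) • e • w₁ by
          push_cast; rw [add_smul, one_smul, add_right_comm]] at h1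
      rw [show b + (m + 1) = b + 1 + m by ring]
      push_cast at *
      linarith
  have hN : ∀ N : ℕ, (D - C) / 2 - (B w₀ + B w₁) * (1 / Real.sqrt (N + 1 : ℝ)) ≤ Φ w₁ - Φ w₀ := by
    intro N
    have h := htel ((N + 1 : NNReal)⁻¹) (N + 1) 0
    have hne : ((N : NNReal) + 1) ≠ 0 := by positivity
    rw [hBscale, hBscale] at h
    push_cast at h
    rw [zero_add, zero_smul, add_zero, smul_smul, smul_smul, mul_inv_cancel₀ hne, one_smul,
      one_smul] at h
    have hs : Real.sqrt ((N : ℝ) + 1)⁻¹ ^ 3 = (N + 1 : ℝ)⁻¹ * (1 / Real.sqrt (N + 1 : ℝ)) := by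
      rw [pow_succ, Real.sq_sqrt (by positivity), Real.sqrt_inv, one_div]
    rw [hs] at h
    have hne' : (N + 1 : ℝ) ≠ 0 := by positivity
    have e : (N + 1 : ℝ) * ((N + 1 : ℝ)⁻¹ * ((D - C) / 2)
        - ((N + 1 : ℝ)⁻¹ * (1 / Real.sqrt (N + 1 : ℝ)) * B w₀
          + (N + 1 : ℝ)⁻¹ * (1 / Real.sqrt (N + 1 : ℝ)) * B w₁))
        = (D - C) / 2 - (B w₀ + B w₁) * (1 / Real.sqrt (N + 1 : ℝ)) := by
      field_simp
    rw [e] at h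
    linarith
  have hlim : Tendsto (fun N : ℕ => (D - C) / 2
      - (B w₀ + B w₁) * (1 / Real.sqrt (N + 1 : ℝ))) atTop (nhds ((D - C) / 2)) := by
    have h1 : Tendsto (fun N : ℕ => 1 / Real.sqrt (N + 1 : ℝ)) atTop (nhds 0) :=
      (tendsto_const_nhds).div_atTop (Real.tendsto_sqrt_atTop.comp
        (tendsto_natCast_atTop_atTop.atTop_add tendsto_const_nhds))
    simpa using tendsto_const_nhds.sub (h1.const_mul (B w₀ + B w₁))
  exact le_of_tendsto' hlim hN

end GaussianField

section PressureComparison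

lemma lse_le_of_injective {T T' : Type*} [Fintype T] [Fintype T'] [Nonempty T] {Y : T → ℝ}
    {Y' : T' → ℝ} {f : T → T'} (hf : Function.Injective f) (h : ∀ t, Y' (f t) = Y t) :
    lse Y ≤ lse Y' := by
  classical
  unfold lse
  refine Real.log_le_log (sum_exp_pos Y) ?_
  calc ∑ t, Real.exp (Y t) = ∑ t ∈ Finset.univ.map ⟨f, hf⟩, Real.exp (Y' t) := by
        rw [Finset.sum_map]; simp [h]
    _ ≤ _ := Finset.sum_le_sum_of_subset_of_nonneg (Finset.subset_univ _)
        fun _ _ _ => (Real.exp_pos _).le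

lemma lse_prod_add {T T' : Type*} [Fintype T] [Fintype T'] [Nonempty T] [Nonempty T']
    (Y : T → ℝ) (Y' : T' → ℝ) : lse (fun p : T × T' => Y p.1 + Y' p.2) = lse Y + lse Y' := by
  unfold lse
  rw [← Real.log_mul (sum_exp_pos Y).ne' (sum_exp_pos Y').ne', Fintype.sum_mul_sum,
    Fintype.sum_prod_type]
  simp only [Real.exp_add]

lemma lse_const_zero (T : Type*) [Fintype T] :
    lse (fun _ : T => 0) = Real.log (Fintype.card T) := by
  simp [lse]

variable {ι κ T : Type*} [Fintype ι] [Fintype κ]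

lemma gaussPi_zero : gaussPi (fun _ : ι => 0) = Measure.dirac 0 := by
  unfold gaussPi
  simp only [gaussianReal_zero_var]
  rw [← Measure.infinitePi_eq_pi, Measure.infinitePi_dirac]
  rfl

lemma field_zero (c : ι → T → ℝ) : field c 0 = fun _ => 0 := by
  funext t
  simp [field]

lemma field_sumElim (c : ι → T → ℝ) (c' : κ → T → ℝ) (x : ι ⊕ κ → ℝ) (t : T) :
    field (Sum.elim c c') x t
      = field c (fun i => x (Sum.inl i)) t + field c' (fun j => x (Sum.inr j)) t := by
  simp [field, Fintype.sum_sum_type]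

lemma map_smul_gaussPi (a : ℝ) (w : ι → NNReal) :
    (gaussPi w).map (fun x => a • x) = gaussPi (fun k => (a ^ 2).toNNReal * w k) := by
  unfold gaussPi
  have h : ∀ k, (gaussianReal 0 (w k)).map (fun x => a * x)
      = gaussianReal 0 ((a ^ 2).toNNReal * w k) := fun k => by
    rw [gaussianReal_map_const_mul, mul_zero]
    congr 2
    ext
    simp [sq_nonneg]
  have : ∀ k, SigmaFinite ((gaussianReal 0 (w k)).map (fun x => a * x)) := fun k => by
    rw [h]; infer_instance
  have e := Measure.pi_map_pi (μ := fun k => gaussianReal 0 (w k)) (f := fun _ x => a * x)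
    fun k => by fun_prop
  simp only [h] at e
  exact e

variable [Fintype T] [Nonempty T]

lemma integral_lse_field_const_mul (a : ℝ) (w : ι → NNReal) (c : ι → T → ℝ) :
    ∫ x, lse (field (fun k t => a * c k t) x) ∂(gaussPi w)
      = ∫ x, lse (field c x) ∂(gaussPi fun k => (a ^ 2).toNNReal * w k) := by
  rw [← map_smul_gaussPi, integral_map (by fun_prop)
    (CenteredLaw.continuous_lse_comp (continuous_field c)).aestronglyMeasurable]
  congr 1
  funext x
  congr 1
  funext t
  simp only [field, Pi.smul_apply, smul_eq_mul]
  exact Finset.sum_congr rfl fun k _ => by ring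

lemma integral_gaussPi_sumElim (w : ι → NNReal) (w' : κ → NNReal) {f : (ι ⊕ κ → ℝ) → ℝ}
    {h : (ι → ℝ) → (κ → ℝ) → ℝ} (hf : Integrable f (gaussPi (Sum.elim w w')))
    (hfh : ∀ x, f x = h (fun i => x (Sum.inl i)) (fun j => x (Sum.inr j))) :
    ∫ x, f x ∂(gaussPi (Sum.elim w w')) = ∫ x, ∫ y, h x y ∂(gaussPi w') ∂(gaussPi w) := by
  have hp := measurePreserving_sumPiEquivProdPi (X := fun _ : ι ⊕ κ => ℝ)
    (fun k => gaussianReal 0 (Sum.elim w w' k))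
  have e : f = (fun p : (ι → ℝ) × (κ → ℝ) => h p.1 p.2) ∘
      (MeasurableEquiv.sumPiEquivProdPi fun _ : ι ⊕ κ => ℝ) := by
    funext x
    exact hfh x
  have hi : Integrable (fun p : (ι → ℝ) × (κ → ℝ) => h p.1 p.2)
      ((gaussPi w).prod (gaussPi w')) := by
    rw [e] at hf
    exact (hp.integrable_comp_emb (MeasurableEquiv.measurableEmbedding _)).1 hf
  rw [← integral_prod (fun p : (ι → ℝ) × (κ → ℝ) => h p.1 p.2) hi, e]
  exact hp.integral_comp (MeasurableEquiv.measurableEmbedding _)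
    (fun p : (ι → ℝ) × (κ → ℝ) => h p.1 p.2)

end PressureComparison

section Pressure

/-- The pair interactions of the spin profiles `s`. -/
def pairInt {I T : Type*} (s : T → I → ℝ) (k : I × I) (t : T) : ℝ := s t k.1 * s t k.2

lemma abs_pairInt_le {I T : Type*} {s : T → I → ℝ} (hs : ∀ t i, |s t i| = 1) (k : I × I) (t : T) :
    |pairInt s k t| ≤ 1 := by
  simp [pairInt, abs_mul, hs]

/-- The mean log-partition function of the spin profiles `s`, coupled through independent
Gaussians of variance `b`. -/
noncomputable def pressure {I T : Type*} [Fintype I] [Fintype T] (s : T → I → ℝ) (b : NNReal) :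
    ℝ :=
  ∫ x, lse (field (pairInt s) x) ∂(gaussPi fun _ : I × I => b)

variable {I I₁ I₂ T T₁ T₂ : Type*} [Fintype I] [Fintype I₁] [Fintype I₂]

lemma sum_pairInt_mul (s : T → I → ℝ) (t u : T) :
    ∑ k, pairInt s k t * pairInt s k u = (∑ i, s t i * s u i) ^ 2 := by
  rw [sq, Fintype.sum_mul_sum, Fintype.sum_prod_type]
  exact Finset.sum_congr rfl fun i _ => Finset.sum_congr rfl fun j _ => by
    simp only [pairInt]; ring

lemma sum_mul_self_eq_card {s : T → I → ℝ} (hs : ∀ t i, |s t i| = 1) (t : T) :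
    ∑ i, s t i * s t i = Fintype.card I := by
  have : ∀ i, s t i * s t i = 1 := fun i => by rw [← abs_mul_abs_self, hs, one_mul]
  simp [this]

lemma abs_sum_mul_le_card {s : T → I → ℝ} (hs : ∀ t i, |s t i| = 1) (t u : T) :
    |∑ i, s t i * s u i| ≤ Fintype.card I := by
  refine (Finset.abs_sum_le_sum_abs _ _).trans ?_
  simp [abs_mul, hs]

lemma pressure_zero [Fintype T] (s : T → I → ℝ) : pressure s 0 = Real.log (Fintype.card T) := by
  unfold pressure
  rw [gaussPi_zero, integral_dirac, field_zero, lse_const_zero]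

variable [Fintype T] [Fintype T₁] [Fintype T₂] [Nonempty T] [Nonempty T₁] [Nonempty T₂]

lemma pressure_sub_ge {s : T → I → ℝ} (hs : ∀ t i, |s t i| = 1) {b b' : NNReal} {C : ℝ}
    (hC : ∀ t u, ((b' : ℝ) - b) * (∑ i, s t i * s u i) ^ 2 ≤ C) :
    (((b' : ℝ) - b) * (Fintype.card I : ℝ) ^ 2 - C) / 2 ≤ pressure s b' - pressure s b := by
  refine le_integral_lse_field_gaussPi_sub (fun _ => b) (fun _ => b') (abs_pairInt_le hs)
    (fun t => ?_) (fun t u => ?_)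
  · rw [← Finset.mul_sum]
    simp only [sq (pairInt _ _ _)]
    rw [sum_pairInt_mul, sum_mul_self_eq_card hs]
  · rw [← Finset.mul_sum, sum_pairInt_mul]
    exact hC t u

lemma pressure_mono {s : T → I → ℝ} (hs : ∀ t i, |s t i| = 1) {b b' : NNReal} (h : b ≤ b') :
    pressure s b ≤ pressure s b' := by
  have h0 : (0 : ℝ) ≤ b' - b := sub_nonneg.2 (by exact_mod_cast h)
  have := pressure_sub_ge hs (b := b) (b' := b')
    (C := ((b' : ℝ) - b) * (Fintype.card I : ℝ) ^ 2) fun t u => by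
      refine mul_le_mul_of_nonneg_left ?_ h0
      rw [← sq_abs]
      gcongr
      exact abs_sum_mul_le_card hs t u
  linarith

lemma pressure_le {s : T → I → ℝ} (hs : ∀ t i, |s t i| = 1) (b : NNReal) :
    pressure s b ≤ Real.log (Fintype.card T) + b * (Fintype.card I : ℝ) ^ 2 / 2 := by
  have := pressure_sub_ge hs (b := b) (b' := 0) (C := 0) fun t u => by
    have : (0 : ℝ) ≤ b := b.2
    rw [NNReal.coe_zero, zero_sub]
    nlinarith [sq_nonneg (∑ i, s t i * s u i), mul_nonneg this (sq_nonneg (∑ i, s t i * s u i))]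
  rw [pressure_zero, NNReal.coe_zero] at this
  linarith

/-- The pressure of a system split into two blocks dominates the pressures of the blocks. -/
theorem pressure_add_le {s : T₁ × T₂ → I → ℝ} {s₁ : T₁ → I₁ → ℝ} {s₂ : T₂ → I₂ → ℝ}
    (hs : ∀ t i, |s t i| = 1) (hs₁ : ∀ t i, |s₁ t i| = 1) (hs₂ : ∀ t i, |s₂ t i| = 1)
    (hsum : ∀ t u : T₁ × T₂, ∑ i, s t i * s u i
      = ∑ i, s₁ t.1 i * s₁ u.1 i + ∑ i, s₂ t.2 i * s₂ u.2 i)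
    {b b₁ b₂ : NNReal} (hb : ∀ x y : ℝ, b * (x + y) ^ 2 ≤ b₁ * x ^ 2 + b₂ * y ^ 2) :
    pressure s₁ b₁ + pressure s₂ b₂ + (b * (Fintype.card I : ℝ) ^ 2
      - b₁ * (Fintype.card I₁ : ℝ) ^ 2 - b₂ * (Fintype.card I₂ : ℝ) ^ 2) / 2 ≤ pressure s b := by
  let c₁ : (I₁ × I₁) ⊕ (I₂ × I₂) → T₁ × T₂ → ℝ :=
    Sum.elim (fun k t => pairInt s₁ k t.1) (fun k t => pairInt s₂ k t.2)
  let c : ((I₁ × I₁) ⊕ (I₂ × I₂)) ⊕ (I × I) → T₁ × T₂ → ℝ := Sum.elim c₁ (pairInt s)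
  let v₁ : (I₁ × I₁) ⊕ (I₂ × I₂) → NNReal := Sum.elim (fun _ => b₁) (fun _ => b₂)
  have hc₁ : ∀ k t, |c₁ k t| ≤ 1 := by
    rintro (k | k) t
    exacts [abs_pairInt_le hs₁ k t.1, abs_pairInt_le hs₂ k t.2]
  have hc : ∀ k t, |c k t| ≤ 1 := by
    rintro (k | k) t
    exacts [hc₁ k t, abs_pairInt_le hs k t]
  have hcov : ∀ t u, ∑ k, ((Sum.elim (fun _ => 0) (fun _ => b) k : NNReal)
      - (Sum.elim v₁ (fun _ => 0) k : NNReal) : ℝ) * (c k t * c k u)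
      = b * (∑ i, s t i * s u i) ^ 2 - b₁ * (∑ i, s₁ t.1 i * s₁ u.1 i) ^ 2
        - b₂ * (∑ i, s₂ t.2 i * s₂ u.2 i) ^ 2 := by
    intro t u
    simp only [Fintype.sum_sum_type, c, c₁, v₁, Sum.elim_inl, Sum.elim_inr, NNReal.coe_zero]
    rw [← Finset.mul_sum, ← Finset.mul_sum, ← Finset.mul_sum, sum_pairInt_mul, sum_pairInt_mul,
      sum_pairInt_mul]
    ring
  have key := le_integral_lse_field_gaussPi_sub (c := c) (Sum.elim v₁ (fun _ => 0))
    (Sum.elim (fun _ => 0) (fun _ => b)) hc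
    (D := b * (Fintype.card I : ℝ) ^ 2 - b₁ * (Fintype.card I₁ : ℝ) ^ 2
      - b₂ * (Fintype.card I₂ : ℝ) ^ 2) (C := 0)
    (fun t => by
      simp only [sq (c _ _)]
      rw [hcov, sum_mul_self_eq_card hs, sum_mul_self_eq_card hs₁, sum_mul_self_eq_card hs₂])
    (fun t u => by
      rw [hcov, hsum]
      linarith [hb (∑ i, s₁ t.1 i * s₁ u.1 i) (∑ i, s₂ t.2 i * s₂ u.2 i)])
  have e1 : ∫ x, lse (field c x) ∂(gaussPi (Sum.elim (fun _ => 0) (fun _ => b)))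
      = pressure s b := by
    rw [integral_gaussPi_sumElim _ _ (integrable_lse_field_gaussPi _ hc)
      (h := fun x y => lse (fun t => field c₁ x t + field (pairInt s) y t))
      (fun x => congrArg lse (funext fun t => field_sumElim _ _ _ _)),
      gaussPi_zero, integral_dirac, field_zero]
    simp only [zero_add]
    rfl
  have e0 : ∫ x, lse (field c x) ∂(gaussPi (Sum.elim v₁ (fun _ => 0)))
      = pressure s₁ b₁ + pressure s₂ b₂ := by
    rw [integral_gaussPi_sumElim _ _ (integrable_lse_field_gaussPi _ hc)
      (h := fun x y => lse (fun t => field c₁ x t + field (pairInt s) y t))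
      (fun x => congrArg lse (funext fun t => field_sumElim _ _ _ _)), gaussPi_zero]
    simp only [integral_dirac, field_zero, add_zero]
    rw [integral_gaussPi_sumElim _ _ (integrable_lse_field_gaussPi _ hc₁)
      (h := fun x y => lse (field (pairInt s₁) x) + lse (field (pairInt s₂) y))
      (fun x => by
        rw [← lse_prod_add]
        exact congrArg lse (funext fun t => field_sumElim _ _ _ _))]
    have i1 := integrable_lse_field_gaussPi (fun _ => b₁) (abs_pairInt_le hs₁)
    have i2 := integrable_lse_field_gaussPi (fun _ => b₂) (abs_pairInt_le hs₂)
    simp only [integral_add (integrable_const _) i2, integral_const, probReal_univ, one_smul]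
    rw [integral_add i1 (integrable_const _)]
    simp [pressure]
  rw [e0, e1] at key
  linarith

lemma pressure_le_of_injective {T' : Type*} [Fintype T'] [Nonempty T'] {s : T → I → ℝ}
    {s' : T' → I → ℝ} (hs : ∀ t i, |s t i| = 1) (hs' : ∀ t i, |s' t i| = 1) {f : T → T'}
    (hf : Function.Injective f) (h : ∀ t k, pairInt s' k (f t) = pairInt s k t) (b : NNReal) :
    pressure s b ≤ pressure s' b := by
  refine integral_mono (integrable_lse_field_gaussPi _ (abs_pairInt_le hs))
    (integrable_lse_field_gaussPi _ (abs_pairInt_le hs')) fun x => ?_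
  refine lse_le_of_injective hf fun t => ?_
  simp only [field, h]

lemma pressure_prod_fst {T' : Type*} [Fintype T'] [Nonempty T'] {s : T → I → ℝ}
    (hs : ∀ t i, |s t i| = 1) (b : NNReal) :
    pressure (fun p : T × T' => s p.1) b = pressure s b + Real.log (Fintype.card T') := by
  have e : ∀ x, lse (field (pairInt fun p : T × T' => s p.1) x)
      = lse (field (pairInt s) x) + Real.log (Fintype.card T') := fun x => by
    rw [← lse_const_zero, ← lse_prod_add]
    simp only [add_zero]
    rfl
  unfold pressure
  simp only [e]
  rw [integral_add (integrable_lse_field_gaussPi _ (abs_pairInt_le hs)) (integrable_const _)]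
  simp

end Pressure

section Configurations

variable {n : ℕ}

lemma abs_spin (b : Bool) : |spin b| = 1 := by cases b <;> simp [spin]

lemma spin_not (b : Bool) : spin (!b) = -spin b := by cases b <;> simp [spin]

lemma exists_int_sum_spin (σ : Fin n → Bool) :
    ∃ z : ℤ, ∑ i, spin (σ i) = z ∧ Even (z + n) := by
  refine ⟨∑ i, if σ i then 1 else -1, by push_cast; rfl, ?_⟩
  have : (∑ i, if σ i then (1 : ℤ) else -1) + n = ∑ i, ((if σ i then (1 : ℤ) else -1) + 1) := by
    rw [Finset.sum_add_distrib]
    simp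
  rw [this]
  exact Finset.even_sum _ fun i _ => by split_ifs <;> decide

lemma sum_spin_of_isBis {σ : Fin n → Bool} (h : isBis σ) :
    ∑ i, spin (σ i) = 0 ∨ ∑ i, spin (σ i) = 1 ∨ ∑ i, spin (σ i) = -1 := by
  obtain ⟨z, hz, -⟩ := exists_int_sum_spin σ
  unfold isBis at h
  rw [hz] at h ⊢
  have h' : |z| ≤ 1 := by exact_mod_cast h
  rw [abs_le] at h'
  have : z = 0 ∨ z = 1 ∨ z = -1 := by omega
  rcases this with rfl | rfl | rfl <;> simp

lemma sum_spin_sq_of_isBis {σ : Fin n → Bool} (h : isBis σ) :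
    (∑ i, spin (σ i)) ^ 2 = ((n % 2 : ℕ) : ℝ) := by
  obtain ⟨z, hz, hev⟩ := exists_int_sum_spin σ
  unfold isBis at h
  rw [hz] at h ⊢
  have h' : |z| ≤ 1 := by exact_mod_cast h
  rw [abs_le] at h'
  obtain ⟨m, hm⟩ := hev
  have h3 : z = 0 ∨ z = 1 ∨ z = -1 := by omega
  have : z ^ 2 = ((n % 2 : ℕ) : ℤ) := by
    rcases h3 with rfl | rfl | rfl <;> norm_num <;> omega
  rw [← Int.cast_pow, this, Int.cast_natCast]

/-- Configurations with total spin `0` or `1`. -/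
def isPos (σ : Fin n → Bool) : Prop := ∑ i, spin (σ i) = 0 ∨ ∑ i, spin (σ i) = 1

lemma isPos.isBis {σ : Fin n → Bool} (h : isPos σ) : isBis σ := by
  unfold _root_.isBis
  rcases h with h | h <;> simp [h]

lemma exists_isPos (n : ℕ) : ∃ σ : Fin n → Bool, isPos σ := by
  refine ⟨fun i => decide (i.1 % 2 = 0), ?_⟩
  have key : ∀ m : ℕ, ∑ i : Fin m, spin (decide (i.1 % 2 = 0)) = if m % 2 = 0 then 0 else 1 := by
    intro m
    induction m with
    | zero => simp
    | succ m ih =>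
      rw [Fin.sum_univ_castSucc]
      simp only [Fin.val_castSucc, Fin.val_last]
      rw [ih]
      rcases Nat.mod_two_eq_zero_or_one m with h | h
      · have : (m + 1) % 2 ≠ 0 := by omega
        simp [h, this, spin]
      · have : (m + 1) % 2 = 0 := by omega
        simp [h, this, spin]
  unfold isPos
  rw [key]
  split_ifs <;> simp

/-- The bisections of `Fin n`. -/
abbrev BisConf (n : ℕ) := {σ : Fin n → Bool // isBis σ}

/-- The bisections of `Fin n` with nonnegative total spin. -/
abbrev PosConf (n : ℕ) := {σ : Fin n → Bool // isPos σ}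

noncomputable instance (n : ℕ) : Fintype (BisConf n) := Fintype.ofFinite _

noncomputable instance (n : ℕ) : Fintype (PosConf n) := Fintype.ofFinite _

instance (n : ℕ) : Nonempty (PosConf n) := nonempty_subtype.2 (exists_isPos n)

instance (n : ℕ) : Nonempty (BisConf n) :=
  nonempty_subtype.2 ((exists_isPos n).imp fun _ h => h.isBis)

/-- The spin profile of a bisection. -/
def bisSpin (σ : BisConf n) (i : Fin n) : ℝ := spin (σ.1 i)

/-- The spin profile of a bisection with nonnegative total spin. -/
def posSpin (σ : PosConf n) (i : Fin n) : ℝ := spin (σ.1 i)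

lemma abs_bisSpin (σ : BisConf n) (i : Fin n) : |bisSpin σ i| = 1 := abs_spin _

lemma abs_posSpin (σ : PosConf n) (i : Fin n) : |posSpin σ i| = 1 := abs_spin _

lemma pressure_posSpin_le (n : ℕ) (b : NNReal) :
    pressure (posSpin (n := n)) b ≤ pressure (bisSpin (n := n)) b :=
  pressure_le_of_injective abs_posSpin abs_bisSpin (f := fun σ => ⟨σ.1, σ.2.isBis⟩)
    (fun _ _ h => Subtype.ext (Subtype.mk.inj h)) (fun _ _ => rfl) b

lemma pressure_bisSpin_le (n : ℕ) (b : NNReal) :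
    pressure (bisSpin (n := n)) b ≤ pressure (posSpin (n := n)) b + Real.log 2 := by
  classical
  have hneg : ∀ σ : BisConf n, ¬ isPos σ.1 → isPos fun i => !σ.1 i := fun σ h => by
    rcases sum_spin_of_isBis σ.2 with h' | h' | h'
    · exact absurd (Or.inl h') h
    · exact absurd (Or.inr h') h
    · right
      simp [spin_not, h']
  let f : BisConf n → PosConf n × Bool := fun σ =>
    if h : isPos σ.1 then (⟨σ.1, h⟩, true) else (⟨fun i => !σ.1 i, hneg σ h⟩, false)
  have hf : Function.Injective f := by
    intro σ τ h
    apply Subtype.ext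
    by_cases h1 : isPos σ.1 <;> by_cases h2 : isPos τ.1
    · simpa [f, h1, h2] using h
    · simp [f, h1, h2] at h
    · simp [f, h1, h2] at h
    · simp only [f, h1, h2, dif_neg, not_false_eq_true, Prod.mk.injEq, Subtype.mk.injEq,
        and_true] at h
      funext i
      simpa using congrFun h i
  have h := pressure_le_of_injective (s' := fun p : PosConf n × Bool => posSpin p.1) abs_bisSpin
    (fun p => abs_posSpin p.1) hf (fun σ k => by
      by_cases h1 : isPos σ.1
      · simp [f, h1, pairInt, posSpin, bisSpin]
      · simp [f, h1, pairInt, posSpin, bisSpin, spin_not]) b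
  rw [pressure_prod_fst abs_posSpin] at h
  simpa using h

lemma pressure_posSpin_add_le {m₁ m₂ : ℕ} {b b₁ b₂ : NNReal}
    (hb : ∀ x y : ℝ, b * (x + y) ^ 2 ≤ b₁ * x ^ 2 + b₂ * y ^ 2) :
    pressure (posSpin (n := m₁)) b₁ + pressure (posSpin (n := m₂)) b₂
      + (b * ((m₁ + m₂ : ℕ) : ℝ) ^ 2 - b₁ * (m₁ : ℝ) ^ 2 - b₂ * (m₂ : ℝ) ^ 2) / 2
      ≤ pressure (posSpin (n := m₁ + m₂)) b + Real.log 2 := by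
  let glue : PosConf m₁ × PosConf m₂ → Fin (m₁ + m₂) → Bool := fun p =>
    Fin.append p.1.1 fun i => !p.2.1 i
  have hbis : ∀ p, isBis (glue p) := fun p => by
    have e : ∑ i, spin (glue p i) = ∑ i, spin (p.1.1 i) - ∑ i, spin (p.2.1 i) := by
      rw [Fin.sum_univ_add, sub_eq_add_neg, ← Finset.sum_neg_distrib]
      simp [glue, spin_not]
    unfold isBis
    rw [e]
    rcases p.1.2 with h | h <;> rcases p.2.2 with h' | h' <;> simp [h, h']
  have h1 := pressure_add_le (s := fun p i => spin (glue p i)) (s₁ := posSpin (n := m₁))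
    (s₂ := posSpin (n := m₂)) (fun p i => abs_spin _) abs_posSpin abs_posSpin
    (fun t u => by
      rw [Fin.sum_univ_add]
      simp [glue, spin_not, posSpin]) hb
  have h2 := pressure_le_of_injective (s := fun p i => spin (glue p i))
    (s' := bisSpin (n := m₁ + m₂)) (f := fun p => ⟨glue p, hbis p⟩) (fun p i => abs_spin _)
    abs_bisSpin (fun p q h => by
      have h' : glue p = glue q := congrArg Subtype.val h
      refine Prod.ext (Subtype.ext (funext fun i => ?_)) (Subtype.ext (funext fun i => ?_))
      · simpa [glue] using congrFun h' (Fin.castAdd m₂ i)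
      · simpa [glue] using congrFun h' (Fin.natAdd m₁ i)) (fun _ _ => rfl) b
  have h3 := pressure_bisSpin_le (m₁ + m₂) b
  simp only [Fintype.card_fin] at h1
  linarith

end Configurations

section Limit

/-- The log-partition function of the bisections, with entries of variance `θ / (2 n)`. -/
noncomputable def skPressure (n : ℕ) (θ : NNReal) : ℝ :=
  pressure (bisSpin (n := n)) (θ / (2 * n))

lemma skPressure_le (n : ℕ) (θ : NNReal) :
    skPressure n θ ≤ n * (Real.log 2 + θ / 4) := by
  have h := pressure_le (s := bisSpin (n := n)) abs_bisSpin (θ / (2 * n))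
  have hcard : Real.log (Fintype.card (BisConf n)) ≤ n * Real.log 2 := by
    rw [← Real.log_pow]
    refine Real.log_le_log (by exact_mod_cast Fintype.card_pos) ?_
    have : Fintype.card (BisConf n) ≤ Fintype.card (Fin n → Bool) :=
      Fintype.card_le_of_injective _ Subtype.val_injective
    rw [Fintype.card_fun, Fintype.card_bool, Fintype.card_fin] at this
    exact_mod_cast this
  have e : ((θ / (2 * n) : NNReal) : ℝ) * (Fintype.card (Fin n) : ℝ) ^ 2 / 2 = n * (θ / 4) := by
    rcases Nat.eq_zero_or_pos n with rfl | hn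
    · simp
    · push_cast
      rw [Fintype.card_fin]
      have : (n : ℝ) ≠ 0 := by positivity
      field_simp
      norm_num
  rw [e] at h
  unfold skPressure
  linarith

lemma skPressure_mono (n : ℕ) {θ θ' : NNReal} (h : θ ≤ θ') : skPressure n θ ≤ skPressure n θ' :=
  pressure_mono abs_bisSpin (by gcongr)

/-- The mean free energy per site of the bisections converges. -/
theorem exists_tendsto_skPressure (θ : NNReal) :
    ∃ L : ℝ, Tendsto (fun n : ℕ => skPressure n θ / n) atTop (nhds L) ∧
      Tendsto (fun n : ℕ => pressure (posSpin (n := n)) (θ / (2 * n)) / n) atTop (nhds L) := by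
  set u : ℕ → ℝ := fun n => Real.log 2 - pressure (posSpin (n := n)) (θ / (2 * n)) with hu
  have hzero : u 0 = Real.log 2 := by
    have : Fintype.card (PosConf 0) = 1 := by
      have h0 : Nonempty (PosConf 0) := inferInstance
      have h1 : Subsingleton (PosConf 0) := inferInstance
      exact Fintype.card_eq_one_iff.2 ⟨Classical.arbitrary _, fun _ => Subsingleton.elim _ _⟩
    simp [hu, pressure_zero, this]
  have hsub : Subadditive u := by
    intro m k
    rcases Nat.eq_zero_or_pos m with rfl | hm
    · rw [zero_add, hzero]
      linarith [Real.log_nonneg one_le_two]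
    rcases Nat.eq_zero_or_pos k with rfl | hk
    · rw [add_zero, hzero]
      linarith [Real.log_nonneg one_le_two]
    have hm' : (0 : ℝ) < m := by exact_mod_cast hm
    have hk' : (0 : ℝ) < k := by exact_mod_cast hk
    have h := pressure_posSpin_add_le (m₁ := m) (m₂ := k) (b := θ / (2 * (m + k : ℕ)))
      (b₁ := θ / (2 * m)) (b₂ := θ / (2 * k)) fun x y => by
        push_cast
        have hθ : (0 : ℝ) ≤ θ := θ.2
        have : (x + y) ^ 2 / (m + k) ≤ x ^ 2 / m + y ^ 2 / k := by
          rw [div_add_div _ _ hm'.ne' hk'.ne', div_le_div_iff₀ (by positivity) (by positivity)]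
          nlinarith [sq_nonneg (x * k - y * m)]
        calc (θ : ℝ) / (2 * (m + k)) * (x + y) ^ 2 = θ / 2 * ((x + y) ^ 2 / (m + k)) := by
              field_simp
          _ ≤ θ / 2 * (x ^ 2 / m + y ^ 2 / k) := by gcongr
          _ = _ := by field_simp
    have e : (((θ / (2 * (m + k : ℕ)) : NNReal) : ℝ) * ((m + k : ℕ) : ℝ) ^ 2
        - ((θ / (2 * m) : NNReal) : ℝ) * (m : ℝ) ^ 2
        - ((θ / (2 * k) : NNReal) : ℝ) * (k : ℝ) ^ 2) / 2 = 0 := by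
      push_cast
      field_simp
      ring
    rw [e] at h
    simp only [hu]
    linarith
  have hbdd : BddBelow (Set.range fun n => u n / n) := by
    refine ⟨-(Real.log 2 + θ / 4), ?_⟩
    rintro _ ⟨n, rfl⟩
    have h1 := skPressure_le n θ
    have h2 := pressure_posSpin_le n (θ / (2 * n))
    have h3 := Real.log_nonneg one_le_two
    rcases Nat.eq_zero_or_pos n with rfl | hn
    · simp only [Nat.cast_zero, div_zero]
      linarith [θ.2, (by positivity : (0 : ℝ) ≤ θ / 4)]
    · have hn' : (0 : ℝ) < n := by exact_mod_cast hn
      simp only [hu]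
      rw [le_div_iff₀ hn']
      unfold skPressure at h1
      linarith
  have hlim := hsub.tendsto_lim hbdd
  have hlog : Tendsto (fun n : ℕ => Real.log 2 / n) atTop (nhds 0) :=
    tendsto_const_nhds.div_atTop tendsto_natCast_atTop_atTop
  have hpos : Tendsto (fun n : ℕ => pressure (posSpin (n := n)) (θ / (2 * n)) / n) atTop
      (nhds (-hsub.lim)) := by
    have := hlog.sub hlim
    rw [zero_sub] at this
    refine this.congr fun n => ?_
    simp only [hu]
    ring
  refine ⟨_, ?_, hpos⟩
  refine tendsto_of_tendsto_of_tendsto_of_le_of_le hpos (by simpa using hpos.add hlog)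
    (fun n => ?_) (fun n => ?_)
  · dsimp only
    gcongr
    exact pressure_posSpin_le n _
  · dsimp only
    rw [← add_div]
    gcongr
    exact pressure_bisSpin_le n _

/-- The limiting free energy per site of the bisections. -/
noncomputable def skLimit (θ : NNReal) : ℝ := (exists_tendsto_skPressure θ).choose

lemma tendsto_skPressure (θ : NNReal) :
    Tendsto (fun n : ℕ => skPressure n θ / n) atTop (nhds (skLimit θ)) :=
  (exists_tendsto_skPressure θ).choose_spec.1

lemma skLimit_mono {θ θ' : NNReal} (h : θ ≤ θ') : skLimit θ ≤ skLimit θ' :=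
  le_of_tendsto_of_tendsto' (tendsto_skPressure θ) (tendsto_skPressure θ') fun n => by
    have := skPressure_mono n h
    gcongr

/-- A quantitative concavity of the limiting free energy in the inverse of the parameter. -/
theorem skLimit_split {θ θ₁ θ₂ : NNReal}
    (hθ : ∀ x y : ℝ, (θ : ℝ) / 2 * (x + y) ^ 2 ≤ θ₁ * x ^ 2 + θ₂ * y ^ 2) :
    (skLimit θ₁ + skLimit θ₂) / 2 + (θ - (θ₁ + θ₂) / 2) / 4 ≤ skLimit θ := by
  have h0 := (exists_tendsto_skPressure θ).choose_spec.2
  have h1 := (exists_tendsto_skPressure θ₁).choose_spec.2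
  have h2 := (exists_tendsto_skPressure θ₂).choose_spec.2
  have hdouble : Tendsto (fun m : ℕ => m + m) atTop atTop := tendsto_id.atTop_add_atTop tendsto_id
  have hlog : Tendsto (fun n : ℕ => Real.log 2 / n) atTop (nhds 0) :=
    tendsto_const_nhds.div_atTop tendsto_natCast_atTop_atTop
  have h3 := (h0.comp hdouble).add (hlog.comp hdouble)
  rw [add_zero] at h3
  have h4 := ((h1.add h2).div_const 2).add_const (((θ : ℝ) - (θ₁ + θ₂) / 2) / 4)
  refine le_of_tendsto_of_tendsto h4 h3 ?_
  filter_upwards [eventually_gt_atTop 0] with m hm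
  have hm' : (0 : ℝ) < m := by exact_mod_cast hm
  have h := pressure_posSpin_add_le (m₁ := m) (m₂ := m) (b := θ / (2 * (m + m : ℕ)))
    (b₁ := θ₁ / (2 * m)) (b₂ := θ₂ / (2 * m)) fun x y => by
      push_cast
      have := div_le_div_of_nonneg_right (hθ x y) (by positivity : (0 : ℝ) ≤ 2 * m)
      calc (θ : ℝ) / (2 * (m + m)) * (x + y) ^ 2 = θ / 2 * (x + y) ^ 2 / (2 * m) := by
            field_simp
            ring
        _ ≤ _ := this
        _ = _ := by ring
  simp only [Function.comp_apply]
  rw [← add_div _ (Real.log 2), le_div_iff₀ (by exact_mod_cast Nat.add_pos_left hm m)]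
  refine le_trans (le_of_eq ?_) h
  push_cast
  field_simp
  ring

end Limit

section Poisson

open scoped Nat

lemma hasSum_poisson_mul_succ {r : NNReal} {g : ℕ → ℝ} {S : ℝ}
    (h : HasSum (fun k : ℕ => Real.exp (-r) * r ^ k / k ! * g (k + 1)) S) :
    HasSum (fun k : ℕ => Real.exp (-r) * r ^ k / k ! * (k * g k)) (r * S) := by
  refine (hasSum_nat_add_iff' 1).1 ?_
  simp only [Finset.range_one, Finset.sum_singleton, Nat.cast_zero, zero_mul, mul_zero, sub_zero]
  refine (h.mul_left (r : ℝ)).congr_fun ?_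
  intro k
  rw [Nat.factorial_succ]
  have h1 : (k ! : ℝ) ≠ 0 := by exact_mod_cast Nat.factorial_ne_zero k
  have h2 : ((k : ℝ) + 1) ≠ 0 := by positivity
  push_cast
  field_simp
  ring

lemma integrable_and_integral_poisson {r : NNReal} {f : ℕ → ℝ} (hf : ∀ k, 0 ≤ f k) {S : ℝ}
    (h : HasSum (fun k : ℕ => Real.exp (-r) * r ^ k / k ! * f k) S) :
    Integrable f (poissonMeasure r) ∧ ∫ k, f k ∂(poissonMeasure r) = S := by
  constructor
  · rw [integrable_poissonMeasure_iff]
    simpa only [Real.norm_of_nonneg (hf _)] using h.summable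
  · rw [integral_poissonMeasure]
    exact h.tsum_eq

lemma integral_poisson_moments (r : NNReal) :
    (Integrable (fun k : ℕ => (k : ℝ)) (poissonMeasure r) ∧
      ∫ k : ℕ, (k : ℝ) ∂(poissonMeasure r) = r) ∧
    (Integrable (fun k : ℕ => (k : ℝ) ^ 2) (poissonMeasure r) ∧
      ∫ k : ℕ, (k : ℝ) ^ 2 ∂(poissonMeasure r) = r ^ 2 + r) ∧
    (Integrable (fun k : ℕ => (k : ℝ) ^ 3) (poissonMeasure r) ∧
      ∫ k : ℕ, (k : ℝ) ^ 3 ∂(poissonMeasure r) = r ^ 3 + 3 * r ^ 2 + r) := by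
  have h0 := hasSum_one_poissonMeasure r
  have h1 : HasSum (fun k : ℕ => Real.exp (-r) * r ^ k / k ! * (k : ℝ)) r := by
    have := hasSum_poisson_mul_succ (r := r) (g := fun _ => 1) (S := 1) (by simpa using h0)
    rw [mul_one (r : ℝ)] at this
    simpa only [mul_one] using this
  have h2 : HasSum (fun k : ℕ => Real.exp (-r) * r ^ k / k ! * (k : ℝ) ^ 2) (r ^ 2 + r) := by
    have := hasSum_poisson_mul_succ (r := r) (g := fun k => (k : ℝ)) (S := r + 1)
      ((h1.add h0).congr_fun fun k => by push_cast; ring)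
    simpa only [← sq, mul_add, mul_one] using this
  have h3 : HasSum (fun k : ℕ => Real.exp (-r) * r ^ k / k ! * (k : ℝ) ^ 3)
      (r ^ 3 + 3 * r ^ 2 + r) := by
    have := hasSum_poisson_mul_succ (r := r) (g := fun k => (k : ℝ) ^ 2)
      (S := (r ^ 2 + r) + 2 * r + 1)
      (((h2.add (h1.mul_left 2)).add h0).congr_fun fun k => by push_cast; ring)
    rw [show (r : ℝ) ^ 3 + 3 * r ^ 2 + r = r * ((r ^ 2 + r) + 2 * r + 1) by ring]
    simpa only [← pow_succ'] using this
  exact ⟨integrable_and_integral_poisson (fun k => by positivity) h1,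
    integrable_and_integral_poisson (fun k => by positivity) h2,
    integrable_and_integral_poisson (fun k => by positivity) h3⟩

/-- The centred and rescaled Poisson law. -/
lemma centeredLaw_poisson {r : NNReal} (hr : r ≤ 1) {a : ℝ} (ha : 0 < a) :
    CenteredLaw ((poissonMeasure r).map fun k : ℕ => ((k : ℝ) - r) / a) (r / a ^ 2)
      (6 * r / a ^ 3) := by
  obtain ⟨⟨i1, e1⟩, ⟨i2, e2⟩, ⟨i3, e3⟩⟩ := integral_poisson_moments r
  have hm : Measurable fun k : ℕ => ((k : ℝ) - r) / a := .of_discrete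
  have hr1 : (r : ℝ) ≤ 1 := by exact_mod_cast hr
  have hr0 : (0 : ℝ) ≤ r := r.2
  have hbd : ∀ k : ℕ, |((k : ℝ) - r) / a| ^ 3 ≤ ((k : ℝ) ^ 3 + r ^ 3) / a ^ 3 := fun k => by
    rw [abs_div, abs_of_pos ha, div_pow]
    gcongr
    have hk : (0 : ℝ) ≤ k := k.cast_nonneg
    rcases le_total (k : ℝ) r with h | h
    · rw [abs_of_nonpos (by linarith)]
      have : (-((k : ℝ) - r)) ^ 3 ≤ (r : ℝ) ^ 3 :=
        pow_le_pow_left₀ (by linarith) (by linarith) 3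
      have := pow_nonneg hk 3
      linarith
    · rw [abs_of_nonneg (by linarith)]
      have : ((k : ℝ) - r) ^ 3 ≤ (k : ℝ) ^ 3 :=
        pow_le_pow_left₀ (by linarith) (by linarith) 3
      have := pow_nonneg hr0 3
      linarith
  have ibd : Integrable (fun k : ℕ => ((k : ℝ) ^ 3 + r ^ 3) / a ^ 3) (poissonMeasure r) :=
    (i3.add (integrable_const _)).div_const _
  have icube : Integrable (fun k : ℕ => |((k : ℝ) - r) / a| ^ 3) (poissonMeasure r) :=
    ibd.mono' (by fun_prop) (ae_of_all _ fun k => by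
      rw [Real.norm_of_nonneg (by positivity)]
      exact hbd k)
  refine ⟨Measure.isProbabilityMeasure_map hm.aemeasurable, ?_, ?_, ?_, ?_⟩
  · rw [integrable_map_measure (by fun_prop) hm.aemeasurable]
    exact icube
  · rw [integral_map hm.aemeasurable (by fun_prop), integral_div,
      integral_sub i1 (integrable_const _), e1]
    simp
  · rw [integral_map hm.aemeasurable (by fun_prop)]
    have : ∀ k : ℕ, (((k : ℝ) - r) / a) ^ 2 = ((k : ℝ) ^ 2 - 2 * r * k + r ^ 2) / a ^ 2 :=
      fun k => by rw [div_pow]; ring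
    simp only [this]
    rw [integral_div, integral_add (integrable_fun_sub i2 (i1.const_mul _)) (integrable_const _),
      integral_sub i2 (i1.const_mul _), integral_const_mul, e1, e2]
    simp only [integral_const, probReal_univ, smul_eq_mul]
    ring
  · rw [integral_map hm.aemeasurable (by fun_prop)]
    refine (integral_mono icube ibd hbd).trans ?_
    rw [integral_div, integral_add i3 (integrable_const _), e3]
    simp only [integral_const, probReal_univ, smul_eq_mul]
    gcongr
    nlinarith [mul_nonneg hr0 (sub_nonneg.2 hr1),
      mul_nonneg (mul_nonneg hr0 hr0) (sub_nonneg.2 hr1)]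

end Poisson

section Flatten

lemma map_uncurry_pi {I J E : Type*} [Fintype I] [Fintype J] [MeasurableSpace E] (μ : Measure E)
    [IsProbabilityMeasure μ] :
    (Measure.pi fun _ : I => Measure.pi fun _ : J => μ).map (fun X (k : I × J) => X k.1 k.2)
      = Measure.pi fun _ : I × J => μ := by
  symm
  refine Measure.pi_eq fun s hs => ?_
  have hm : Measurable fun (X : I → J → E) (k : I × J) => X k.1 k.2 := by fun_prop
  rw [Measure.map_apply hm (MeasurableSet.univ_pi hs)]
  have : (fun (X : I → J → E) (k : I × J) => X k.1 k.2) ⁻¹' (Set.univ.pi s)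
      = Set.univ.pi fun i => Set.univ.pi fun j => s (i, j) := by
    ext X
    simp [Set.mem_pi]
  rw [this, Measure.pi_pi]
  simp only [Measure.pi_pi, Fintype.prod_prod_type]

end Flatten

section Overlap

variable {n : ℕ}

/-- The Gibbs average of the squared overlap of two bisections for the energy profile `Y`. -/
noncomputable def overlapSq (Y : BisConf n → ℝ) : ℝ :=
  gavg Y fun σ => gavg Y fun τ => overlap σ.1 τ.1 ^ 2

lemma gavg_add_right {T : Type*} [Fintype T] (Y f : T → ℝ) (a : ℝ) :
    gavg (fun t => Y t + a) f = gavg Y f := by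
  simp only [gavg, Real.exp_add, ← mul_assoc, ← Finset.sum_mul]
  exact mul_div_mul_right _ _ (Real.exp_pos a).ne'

lemma overlapSq_add_right (Y : BisConf n → ℝ) (a : ℝ) :
    overlapSq (fun σ => Y σ + a) = overlapSq Y := by
  simp only [overlapSq, gavg_add_right]

open scoped Classical in
lemma sum_ite_isBis (f : (Fin n → Bool) → ℝ) :
    (∑ σ : Fin n → Bool, if isBis σ then f σ else 0) = ∑ σ : BisConf n, f σ.1 := by
  rw [← Finset.sum_filter]
  exact Finset.sum_subtype _ (by simp) f

lemma sum_mul_gibbsBis (β : ℝ) (X : Fin n → Fin n → ℝ) (f : (Fin n → Bool) → ℝ) :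
    ∑ σ, f σ * gibbsBis β X σ
      = gavg (fun σ : BisConf n => -β * Ham X σ.1) fun σ => f σ.1 := by
  simp only [gibbsBis, ZpartBis, gavg, mul_ite, mul_zero]
  rw [sum_ite_isBis, sum_ite_isBis, Finset.sum_div]
  simp only [mul_div_assoc]

lemma avg2Bis_overlap (β : ℝ) (X : Fin n → Fin n → ℝ) :
    avg2Bis β X (fun σ1 σ2 => overlap σ1 σ2 ^ 2)
      = overlapSq fun σ : BisConf n => -β * Ham X σ.1 := by
  have h : ∀ σ1 : Fin n → Bool,
      ∑ σ2, overlap σ1 σ2 ^ 2 * gibbsBis β X σ1 * gibbsBis β X σ2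
        = (∑ σ2, overlap σ1 σ2 ^ 2 * gibbsBis β X σ2) * gibbsBis β X σ1 := fun σ1 => by
    rw [Finset.sum_mul]
    exact Finset.sum_congr rfl fun _ _ => by ring
  unfold avg2Bis avg2cBis
  simp only [h, sum_mul_gibbsBis]
  rfl

/-- The interactions of the bisection model at inverse temperature `β`. -/
def bisInt (n : ℕ) (β : ℝ) (k : Fin n × Fin n) (σ : BisConf n) : ℝ := -β * pairInt bisSpin k σ

lemma abs_bisInt_le (β : ℝ) (k : Fin n × Fin n) (σ : BisConf n) : |bisInt n β k σ| ≤ |β| := by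
  rw [bisInt, abs_mul, abs_neg]
  exact mul_le_of_le_one_right (abs_nonneg β) (abs_pairInt_le abs_bisSpin k σ)

lemma neg_mul_Ham (β : ℝ) (X : Fin n → Fin n → ℝ) (σ : BisConf n) :
    -β * Ham X σ.1 = field (bisInt n β) (fun k => X k.1 k.2) σ := by
  simp only [Ham, field, bisInt, pairInt, bisSpin, Finset.mul_sum, Fintype.sum_prod_type]
  exact Finset.sum_congr rfl fun i _ => Finset.sum_congr rfl fun j _ => by ring

lemma neg_mul_Ham_natMat (β : ℝ) {a : ℝ} (r : ℝ) (A : Fin n → Fin n → ℕ) (σ : BisConf n) :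
    -(β / a) * Ham (natMat A) σ.1
      = field (bisInt n β) (fun k => ((A k.1 k.2 : ℝ) - r) / a) σ
        + -(β / a) * r * ((n % 2 : ℕ) : ℝ) := by
  rw [← sum_spin_sq_of_isBis σ.2, sq, Fintype.sum_mul_sum]
  simp only [Ham, natMat, field, bisInt, pairInt, bisSpin, Finset.mul_sum, Fintype.sum_prod_type,
    ← Finset.sum_add_distrib]
  exact Finset.sum_congr rfl fun i _ => Finset.sum_congr rfl fun j _ => by ring

lemma overlapSq_nonneg (Y : BisConf n → ℝ) : 0 ≤ overlapSq Y := by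
  rw [← gavg_const Y 0]
  refine gavg_mono Y fun σ => ?_
  rw [← gavg_const Y 0]
  exact gavg_mono Y fun τ => sq_nonneg _

lemma sum_gvar_bisInt (hn : n ≠ 0) (β : ℝ) (Y : BisConf n → ℝ) :
    ∑ k, gvar Y (bisInt n β k) = β ^ 2 * (n : ℝ) ^ 2 * (1 - overlapSq Y) := by
  have hn' : (n : ℝ) ≠ 0 := by exact_mod_cast hn
  have h1 : ∀ k, gvar Y (bisInt n β k)
      = β ^ 2 - β ^ 2 * gavg Y (fun σ => gavg Y fun τ =>
        pairInt bisSpin k σ * pairInt bisSpin k τ) := fun k => by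
    have e1 : ∀ σ, bisInt n β k σ ^ 2 = β ^ 2 := fun σ => by
      have : pairInt bisSpin k σ ^ 2 = 1 := by
        rw [← sq_abs, pairInt, abs_mul, abs_bisSpin, abs_bisSpin]; norm_num
      rw [bisInt, mul_pow, this]; ring
    have e2 : gavg Y (bisInt n β k) = -β * gavg Y (pairInt bisSpin k) :=
      gavg_const_mul Y (pairInt bisSpin k) (-β)
    have e3 : ∀ σ, gavg Y (fun τ => pairInt bisSpin k σ * pairInt bisSpin k τ)
        = gavg Y (pairInt bisSpin k) * pairInt bisSpin k σ := fun σ => by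
      rw [gavg_const_mul Y (pairInt bisSpin k), mul_comm]
    simp only [gvar, e1, e2, e3, gavg_const]
    rw [gavg_const_mul Y (pairInt bisSpin k)]
    ring
  have h2 : ∑ k, gavg Y (fun σ => gavg Y fun τ => pairInt bisSpin k σ * pairInt bisSpin k τ)
      = (n : ℝ) ^ 2 * overlapSq Y := by
    unfold overlapSq
    rw [← gavg_sum, ← gavg_const_mul]
    congr 1
    funext σ
    rw [← gavg_sum, ← gavg_const_mul]
    congr 1
    funext τ
    rw [sum_pairInt_mul, overlap, ← mul_pow]
    simp only [bisSpin]
    field_simp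
  simp only [h1]
  rw [Finset.sum_sub_distrib, ← Finset.mul_sum, h2]
  simp only [Finset.sum_const, Finset.card_univ, Fintype.card_prod, Fintype.card_fin,
    nsmul_eq_mul]
  push_cast
  ring

lemma continuous_overlapSq_field {ι : Type*} [Fintype ι] (c : ι → BisConf n → ℝ) :
    Continuous fun x => overlapSq (field c x) := by
  unfold overlapSq gavg
  have := continuous_field c
  refine Continuous.div ?_ (by fun_prop) fun x => (sum_exp_pos _).ne'
  refine continuous_finsetSum _ fun σ _ => Continuous.mul ?_ (by fun_prop)
  exact Continuous.div (by fun_prop) (by fun_prop) fun x => (sum_exp_pos _).ne'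

lemma integral_skMeasure_overlap (β : ℝ) :
    ∫ g, avg2Bis β g (fun σ1 σ2 => overlap σ1 σ2 ^ 2) ∂(skMeasure n)
      = ∫ x, overlapSq (field (bisInt n β) x)
        ∂(Measure.pi fun _ : Fin n × Fin n => gaussianReal 0 (1 / (2 * n))) := by
  have hu : Measurable fun (X : Fin n → Fin n → ℝ) (k : Fin n × Fin n) => X k.1 k.2 := by fun_prop
  rw [← map_uncurry_pi, integral_map hu.aemeasurable
    (continuous_overlapSq_field _).aestronglyMeasurable]
  simp only [avg2Bis_overlap, neg_mul_Ham]
  rfl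

lemma integral_sparseMeasure_overlap (β d : ℝ) :
    ∫ A, avg2Bis (β / Real.sqrt d) (natMat A) (fun σ1 σ2 => overlap σ1 σ2 ^ 2)
        ∂(sparseMeasure n d)
      = ∫ x, overlapSq (field (bisInt n β) x)
        ∂(Measure.pi fun _ : Fin n × Fin n => (poissonMeasure (d / (2 * n)).toNNReal).map
          fun k : ℕ => ((k : ℝ) - (d / (2 * n)).toNNReal) / Real.sqrt d) := by
  have hm : Measurable fun k : ℕ => ((k : ℝ) - (d / (2 * n)).toNNReal) / Real.sqrt d :=
    .of_discrete
  have hu : Measurable fun (X : Fin n → Fin n → ℕ) (k : Fin n × Fin n) => X k.1 k.2 := by fun_prop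
  have hp : Measurable fun (x : Fin n × Fin n → ℕ) k =>
      ((x k : ℝ) - (d / (2 * n)).toNNReal) / Real.sqrt d :=
    measurable_pi_lambda _ fun k => hm.comp (measurable_pi_apply k)
  have := Measure.isProbabilityMeasure_map (μ := poissonMeasure (d / (2 * n)).toNNReal)
    hm.aemeasurable
  rw [← Measure.pi_map_pi (fun _ => hm.aemeasurable), integral_map hp.aemeasurable
    (continuous_overlapSq_field _).aestronglyMeasurable, ← map_uncurry_pi,
    integral_map hu.aemeasurable]
  · simp only [avg2Bis_overlap, neg_mul_Ham_natMat β ((d / (2 * n)).toNNReal : ℝ),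
      overlapSq_add_right]
    rfl
  · exact ((continuous_overlapSq_field (bisInt n β)).measurable.comp
      hp).aestronglyMeasurable

end Overlap

section Comparison

lemma field_const_mul {ι T : Type*} [Fintype ι] (a : ℝ) (c : ι → T → ℝ) (x : ι → ℝ) (t : T) :
    field (fun k t => a * c k t) x t = a * field c x t := by
  simp only [field, Finset.mul_sum]
  exact Finset.sum_congr rfl fun k _ => by ring

lemma overlapSq_le_one {n : ℕ} (Y : BisConf n → ℝ) : overlapSq Y ≤ 1 := by
  have h : ∀ σ τ : BisConf n, overlap σ.1 τ.1 ^ 2 ≤ 1 := fun σ τ => by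
    have h1 := abs_sum_mul_le_card abs_bisSpin σ τ
    rw [Fintype.card_fin] at h1
    rw [sq_le_one_iff_abs_le_one, overlap, abs_mul, abs_of_nonneg (by positivity)]
    calc 1 / (n : ℝ) * |∑ i, spin (σ.1 i) * spin (τ.1 i)| ≤ 1 / (n : ℝ) * n := by
          gcongr
          exact h1
      _ ≤ 1 := by rw [one_div_mul_eq_div]; exact div_self_le_one _
  rw [← gavg_const Y 1]
  refine gavg_mono Y fun σ => ?_
  rw [← gavg_const Y 1]
  exact gavg_mono Y fun τ => h σ τ

variable {n : ℕ} {ν : Measure ℝ} {κ : ℝ}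

/-- The cubic moment scale of the Gaussian disorder. -/
noncomputable def skCube (n : ℕ) : ℝ :=
  gaussCube * Real.sqrt ((1 / (2 * n) : NNReal) : ℝ) ^ 3

lemma skCube_nonneg (n : ℕ) : 0 ≤ skCube n := mul_nonneg gaussCube_nonneg (by positivity)

lemma CenteredLaw.third_nonneg {v : ℝ} (hν : CenteredLaw ν v κ) : 0 ≤ κ :=
  (integral_nonneg fun x => by positivity).trans hν.cube

lemma integral_lse_bisInt_gaussian (n : ℕ) (β a : ℝ) :
    ∫ x, lse (field (fun k t => a * bisInt n β k t) x)
        ∂(Measure.pi fun _ : Fin n × Fin n => gaussianReal 0 (1 / (2 * n)))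
      = skPressure n ((a * β) ^ 2).toNNReal := by
  have h := integral_lse_field_const_mul (-(a * β))
    (fun _ : Fin n × Fin n => 1 / (2 * (n : NNReal)))
    (pairInt (bisSpin (n := n)))
  have e : (fun (k : Fin n × Fin n) t => a * bisInt n β k t)
      = fun k t => -(a * β) * pairInt bisSpin k t := by
    funext k t
    simp only [bisInt]
    ring
  rw [e]
  refine h.trans ?_
  rw [skPressure, pressure, neg_sq]
  simp only [mul_one_div]

lemma abs_integral_lse_bisInt_sub_le (hν : CenteredLaw ν ((1 / (2 * n) : NNReal) : ℝ) κ) (β : ℝ)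
    {a : ℝ} (ha : |a| ≤ 2) :
    |∫ x, lse (field (fun k t => a * bisInt n β k t) x) ∂(Measure.pi fun _ => ν)
      - skPressure n ((a * β) ^ 2).toNNReal| ≤ (n : ℝ) ^ 2 * (48 * |β| ^ 3 * (κ + skCube n)) := by
  have hc : ∀ (k : Fin n × Fin n) t, |a * bisInt n β k t| ≤ 2 * |β| := fun k t => by
    rw [abs_mul]
    exact mul_le_mul ha (abs_bisInt_le β k t) (abs_nonneg _) zero_le_two
  have h := abs_integral_lse_field_sub_le (centeredLaw_gaussianReal (1 / (2 * n))) hν hc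
  rw [integral_lse_bisInt_gaussian] at h
  refine h.trans (le_of_eq ?_)
  simp only [Fintype.card_prod, Fintype.card_fin, skCube]
  push_cast
  ring

lemma abs_integral_gavg_bisInt_sub_le (hν : CenteredLaw ν ((1 / (2 * n) : NNReal) : ℝ) κ)
    (hn : n ≠ 0) (β : ℝ) :
    |∫ x, gavg (field (bisInt n β) x) (field (bisInt n β) x) ∂(Measure.pi fun _ => ν)
      - n * (β ^ 2 / 2 * (1 - ∫ x, overlapSq (field (bisInt n β) x) ∂(Measure.pi fun _ => ν)))|
      ≤ (n : ℝ) ^ 2 * (12 * |β| ^ 3 * κ) := by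
  have := hν.prob
  have hn' : (n : ℝ) ≠ 0 := by exact_mod_cast hn
  have h := abs_integral_gavg_field_sub_le hν (abs_bisInt_le (n := n) β)
  have iQ : Integrable (fun x => overlapSq (field (bisInt n β) x)) (Measure.pi fun _ => ν) :=
    Integrable.of_bound (continuous_overlapSq_field _).aestronglyMeasurable 1
      (ae_of_all _ fun x => by
        rw [Real.norm_of_nonneg (overlapSq_nonneg _)]
        exact overlapSq_le_one _)
  simp only [← Finset.mul_sum, sum_gvar_bisInt hn] at h
  rw [integral_const_mul, integral_const_mul, integral_sub (integrable_const _) iQ] at h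
  simp only [integral_const, probReal_univ, smul_eq_mul, mul_one, Fintype.card_prod,
    Fintype.card_fin] at h
  push_cast at h
  rw [← sq] at h
  convert h using 3
  field_simp

/-- The tangent bound relating the mean squared overlap to increments of the Gaussian pressure. -/
theorem overlap_tangent_le (hν : CenteredLaw ν ((1 / (2 * n) : NNReal) : ℝ) κ)
    (hn : n ≠ 0) (β : ℝ) {a : ℝ} (ha : |a| ≤ 2) :
    (a - 1) * (β ^ 2 / 2 * (1 - ∫ x, overlapSq (field (bisInt n β) x) ∂(Measure.pi fun _ => ν)))
      ≤ skPressure n ((a * β) ^ 2).toNNReal / n - skPressure n (β ^ 2).toNNReal / n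
        + 200 * |β| ^ 3 * (n * κ + n * skCube n) := by
  have := hν.prob
  have hn' : (0 : ℝ) < n := by exact_mod_cast Nat.pos_of_ne_zero hn
  have hκ := hν.third_nonneg
  have hs := skCube_nonneg n
  set D := ∫ x, gavg (field (bisInt n β) x) (field (bisInt n β) x) ∂(Measure.pi fun _ => ν)
    with hD
  set u := β ^ 2 / 2 * (1 - ∫ x, overlapSq (field (bisInt n β) x) ∂(Measure.pi fun _ => ν))
  have h1 := abs_integral_lse_bisInt_sub_le hν β ha
  have h2 := abs_integral_lse_bisInt_sub_le hν β (a := 1) (by norm_num)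
  have h3 : |D - n * u| ≤ _ := abs_integral_gavg_bisInt_sub_le hν hn β
  have hint : ∀ b : ℝ, Integrable (fun x => lse (field (fun k t => b * bisInt n β k t) x))
      (Measure.pi fun _ => ν) := fun b =>
    integrable_lse_field (fun _ => hν.integrable_id) (M := |b| * |β|) fun k t => by
      rw [abs_mul]
      exact mul_le_mul_of_nonneg_left (abs_bisInt_le β k t) (abs_nonneg b)
  have iD : Integrable (fun x => gavg (field (bisInt n β) x) (field (bisInt n β) x))
      (Measure.pi fun _ => ν) := by
    refine integrable_pi_of_linear_growth (fun _ => hν.integrable_id) (A := 0) (B := |β|) ?_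
      fun x => ?_
    · have := continuous_field (bisInt n β)
      unfold gavg
      exact Continuous.div (by fun_prop) (by fun_prop) fun x => (sum_exp_pos _).ne'
    · rw [zero_add]
      exact abs_gavg_le _ fun t => abs_field_le (abs_bisInt_le β) x t
  have h4 : (a - 1) * D ≤ ∫ x, lse (field (fun k t => a * bisInt n β k t) x)
        ∂(Measure.pi fun _ => ν)
      - ∫ x, lse (field (fun k t => 1 * bisInt n β k t) x) ∂(Measure.pi fun _ => ν) := by
    rw [hD, ← integral_const_mul, ← integral_sub (hint a) (hint 1)]
    refine integral_mono (iD.const_mul _) ((hint a).sub (hint 1)) fun x => ?_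
    have h := gavg_sub_le_lse_sub (field (bisInt n β) x) (field (fun k t => a * bisInt n β k t) x)
    have e : (fun t => field (fun k t => a * bisInt n β k t) x t - field (bisInt n β) x t)
        = fun t => (a - 1) * field (bisInt n β) x t := by
      funext t
      rw [field_const_mul]
      ring
    rw [e, gavg_const_mul] at h
    simpa only [one_mul, Pi.sub_apply] using h
  simp only [one_mul] at h2 h4
  have h5 : |(a - 1) * (D - n * u)| ≤ 3 * ((n : ℝ) ^ 2 * (12 * |β| ^ 3 * κ)) := by
    rw [abs_mul]
    refine mul_le_mul ?_ h3 (abs_nonneg _) (by norm_num)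
    rw [abs_le] at ha ⊢
    constructor <;> linarith
  have h6 : n * ((a - 1) * u) ≤ skPressure n ((a * β) ^ 2).toNNReal
      - skPressure n (β ^ 2).toNNReal + n ^ 2 * (200 * |β| ^ 3 * (κ + skCube n)) := by
    have p1 : 0 ≤ (n : ℝ) ^ 2 * (|β| ^ 3 * κ) := by positivity
    have p2 : 0 ≤ (n : ℝ) ^ 2 * (|β| ^ 3 * skCube n) := by positivity
    rw [abs_le] at h1 h2 h5
    linarith
  rw [← sub_div, ← sub_le_iff_le_add, le_div_iff₀ hn']
  linarith

end Comparison

section Conclusion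

/-- The limiting free energy has matching one-sided slopes in the inverse temperature. -/
lemma skLimit_slope_le (β : ℝ) {δ : ℝ} (h0 : 0 < δ) (h1 : δ ≤ 1 / 8) :
    (skLimit (((1 + δ) * β) ^ 2).toNNReal - skLimit (β ^ 2).toNNReal) / δ
      + (skLimit (((1 - δ + 4 * δ ^ 2) * β) ^ 2).toNNReal - skLimit (β ^ 2).toNNReal)
        / (δ - 4 * δ ^ 2) ≤ 5 / 2 * β ^ 2 * δ := by
  have hδ : 0 < δ - 4 * δ ^ 2 := by nlinarith
  have e : ∀ a : ℝ, (((a * β) ^ 2).toNNReal : ℝ) = a ^ 2 * β ^ 2 := fun a => by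
    rw [Real.coe_toNNReal _ (sq_nonneg _), mul_pow]
  have e1 : ((β ^ 2).toNNReal : ℝ) = β ^ 2 := Real.coe_toNNReal _ (sq_nonneg _)
  have hβ := sq_nonneg β
  have hmono : skLimit (((1 - δ + 4 * δ ^ 2) * β) ^ 2).toNNReal ≤ skLimit (β ^ 2).toNNReal := by
    refine skLimit_mono (Real.toNNReal_le_toNNReal ?_)
    rw [mul_pow]
    refine mul_le_of_le_one_left hβ (pow_le_one₀ ?_ ?_) <;> nlinarith
  have hsplit := skLimit_split (θ := (β ^ 2).toNNReal) (θ₁ := (((1 + δ) * β) ^ 2).toNNReal)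
    (θ₂ := (((1 - δ + 4 * δ ^ 2) * β) ^ 2).toNNReal) (fun x y => by
      rw [e, e, e1]
      have hA : 0 < (1 + δ) ^ 2 - 1 / 2 := by nlinarith
      have hAB : 1 / 4 ≤ ((1 + δ) ^ 2 - 1 / 2) * ((1 - δ + 4 * δ ^ 2) ^ 2 - 1 / 2) := by
        have hsq := sq_nonneg δ
        have h3 : 0 ≤ δ ^ 3 := by positivity
        have h4 : 0 ≤ δ ^ 4 := by positivity
        have h5 : 0 ≤ δ ^ 5 := by positivity
        have h6 : 0 ≤ δ ^ 6 := by positivity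
        nlinarith [mul_nonneg h3 (sub_nonneg.2 h1), mul_nonneg hsq (sub_nonneg.2 h1)]
      have key : 0 ≤ ((1 + δ) ^ 2 - 1 / 2) * x ^ 2 + ((1 - δ + 4 * δ ^ 2) ^ 2 - 1 / 2) * y ^ 2
          - x * y := by
        set A := (1 + δ) ^ 2 - 1 / 2
        set B := (1 - δ + 4 * δ ^ 2) ^ 2 - 1 / 2
        have : 0 ≤ A * (A * x ^ 2 + B * y ^ 2 - x * y) := by
          nlinarith [sq_nonneg (A * x - y / 2), mul_nonneg (sub_nonneg.2 hAB) (sq_nonneg y)]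
        exact nonneg_of_mul_nonneg_right this hA
      nlinarith [mul_nonneg hβ key])
  rw [e, e, e1] at hsplit
  set L₁ := skLimit (((1 + δ) * β) ^ 2).toNNReal
  set L₂ := skLimit (((1 - δ + 4 * δ ^ 2) * β) ^ 2).toNNReal
  set L := skLimit (β ^ 2).toNNReal
  have h2 : (L₂ - L) / (δ - 4 * δ ^ 2) ≤ (L₂ - L) / δ := by
    rw [div_le_div_iff₀ hδ h0]
    nlinarith [mul_nonneg (sub_nonneg.2 hmono) (sq_nonneg δ)]
  have h3 : (L₁ - L) / δ + (L₂ - L) / δ ≤ 5 / 2 * β ^ 2 * δ := by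
    rw [← add_div, div_le_iff₀ h0]
    have h4 : (1 + δ) ^ 2 + (1 - δ + 4 * δ ^ 2) ^ 2 - 2 ≤ 10 * δ ^ 2 := by
      have h3 : 0 ≤ δ ^ 3 := by positivity
      nlinarith [mul_nonneg h3 (sub_nonneg.2 h1)]
    nlinarith [mul_le_mul_of_nonneg_left h4 hβ]
  linarith

lemma tendsto_mul_skCube : Tendsto (fun n : ℕ => n * skCube n) atTop (nhds 0) := by
  have h : Tendsto (fun n : ℕ => gaussCube / 2 * Real.sqrt (1 / (2 * n))) atTop (nhds 0) := by
    have h1 : Tendsto (fun n : ℕ => 1 / 2 * (1 / (n : ℝ))) atTop (nhds (1 / 2 * 0)) :=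
      tendsto_one_div_atTop_nhds_zero_nat.const_mul _
    have h2 := (h1.sqrt).const_mul (gaussCube / 2)
    simpa [mul_comm] using h2
  refine h.congr' ?_
  filter_upwards [eventually_gt_atTop 0] with n hn
  have hn' : (0 : ℝ) < n := by exact_mod_cast hn
  have e : Real.sqrt (1 / (2 * n)) ^ 2 = 1 / (2 * (n : ℝ)) := Real.sq_sqrt (by positivity)
  rw [skCube]
  push_cast
  rw [pow_succ, e]
  field_simp

lemma centeredLaw_sparse {n : ℕ} (hn : n ≠ 0) {d : ℝ} (hd : 0 < d) (hdn : d ≤ 2 * n) :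
    CenteredLaw ((poissonMeasure (d / (2 * n)).toNNReal).map
      fun k : ℕ => ((k : ℝ) - (d / (2 * n)).toNNReal) / Real.sqrt d)
      ((1 / (2 * n) : NNReal) : ℝ) (3 / (n * Real.sqrt d)) := by
  have hn' : (0 : ℝ) < n := by exact_mod_cast Nat.pos_of_ne_zero hn
  have hs : 0 < Real.sqrt d := Real.sqrt_pos.2 hd
  have hr : (d / (2 * n)).toNNReal ≤ 1 := by
    rw [Real.toNNReal_le_one, div_le_one (by positivity)]
    exact hdn
  have h := centeredLaw_poisson hr hs
  have e : ((d / (2 * n)).toNNReal : ℝ) = Real.sqrt d ^ 2 / (2 * n) := by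
    rw [Real.coe_toNNReal _ (by positivity), Real.sq_sqrt hd.le]
  convert h using 1
  · rw [e]
    push_cast
    field_simp
  · rw [e]
    field_simp
    norm_num

/-- The averaged squared overlaps in the Gaussian and in the sparse model agree up to `ε`. -/
theorem eventually_abs_overlap_sub_le {β : ℝ} (hβ : β ≠ 0) {ε : ℝ} (hε : 0 < ε) :
    ∀ᶠ d : ℝ in atTop, ∀ᶠ n : ℕ in atTop,
      |(∫ g, avg2Bis β g (fun σ1 σ2 => (overlap σ1 σ2) ^ 2) ∂(skMeasure n)) -
        ∫ A, avg2Bis (β / Real.sqrt d) (natMat A) (fun σ1 σ2 => (overlap σ1 σ2) ^ 2)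
          ∂(sparseMeasure n d)| ≤ ε := by
  have hβ2 : 0 < β ^ 2 := by positivity
  obtain ⟨δ, h0, h1, hδε⟩ : ∃ δ : ℝ, 0 < δ ∧ δ ≤ 1 / 8 ∧ δ ≤ ε / 24 :=
    ⟨min (1 / 8) (ε / 24), lt_min (by norm_num) (by positivity), min_le_left _ _, min_le_right _ _⟩
  have hδ : 0 < δ - 4 * δ ^ 2 := by nlinarith
  set η : ℝ := β ^ 2 * ε * δ / (4800 * |β| ^ 3) with hη
  have hη0 : 0 < η := by positivity
  have hd : Tendsto (fun d : ℝ => 3 / Real.sqrt d) atTop (nhds 0) :=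
    tendsto_const_nhds.div_atTop Real.tendsto_sqrt_atTop
  filter_upwards [hd.eventually_le_const hη0, eventually_gt_atTop 0] with d hdη hd0
  have hlim := (((tendsto_skPressure (((1 + δ) * β) ^ 2).toNNReal).sub
      (tendsto_skPressure (β ^ 2).toNNReal)).div_const δ).add
    (((tendsto_skPressure (((1 - δ + 4 * δ ^ 2) * β) ^ 2).toNNReal).sub
      (tendsto_skPressure (β ^ 2).toNNReal)).div_const (δ - 4 * δ ^ 2))
  have hlt : 5 / 2 * β ^ 2 * δ < 3 * β ^ 2 * δ := by nlinarith [mul_pos hβ2 h0]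
  filter_upwards [hlim.eventually_le_const ((skLimit_slope_le β h0 h1).trans_lt hlt),
    tendsto_mul_skCube.eventually_le_const (half_pos hη0), eventually_ne_atTop 0,
    eventually_ge_atTop ⌈d / 2⌉₊] with n hslope hcube hn hdn
  have hn' : (0 : ℝ) < n := by exact_mod_cast Nat.pos_of_ne_zero hn
  have hdn' : d ≤ 2 * n := by linarith [Nat.ceil_le.1 hdn]
  rw [integral_skMeasure_overlap, integral_sparseMeasure_overlap]
  have lawG := centeredLaw_gaussianReal (1 / (2 * n))
  have lawP := centeredLaw_sparse hn hd0 hdn'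
  have ha1 : |1 + δ| ≤ 2 := by rw [abs_le]; constructor <;> linarith
  have ha2 : |1 - δ + 4 * δ ^ 2| ≤ 2 := by rw [abs_le]; constructor <;> nlinarith
  have hG1 := overlap_tangent_le lawG hn β ha1
  have hG2 := overlap_tangent_le lawG hn β ha2
  have hP1 := overlap_tangent_le lawP hn β ha1
  have hP2 := overlap_tangent_le lawP hn β ha2
  have eG : gaussCube * Real.sqrt ((1 / (2 * n) : NNReal) : ℝ) ^ 3 = skCube n := rfl
  have eP : (n : ℝ) * (3 / (n * Real.sqrt d)) = 3 / Real.sqrt d := by field_simp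
  rw [eG] at hG1 hG2
  rw [eP] at hP1 hP2
  set QG := ∫ x, overlapSq (field (bisInt n β) x)
    ∂(Measure.pi fun _ : Fin n × Fin n => gaussianReal 0 (1 / (2 * n)))
  set QP := ∫ x, overlapSq (field (bisInt n β) x)
    ∂(Measure.pi fun _ : Fin n × Fin n => (poissonMeasure (d / (2 * n)).toNNReal).map
      fun k : ℕ => ((k : ℝ) - (d / (2 * n)).toNNReal) / Real.sqrt d)
  set p₁ := skPressure n (((1 + δ) * β) ^ 2).toNNReal / n
  set p₂ := skPressure n (((1 - δ + 4 * δ ^ 2) * β) ^ 2).toNNReal / n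
  set p := skPressure n (β ^ 2).toNNReal / n
  set e := β ^ 2 * ε * δ / 16 with he
  have he0 : 0 < e := by positivity
  have hη' : 200 * |β| ^ 3 * (η + η / 2) = e := by
    have : |β| ^ 3 ≠ 0 := by positivity
    rw [hη, he]
    field_simp
    norm_num
  have bG : 200 * |β| ^ 3 * (n * skCube n + n * skCube n) ≤ e := by
    rw [← hη']
    gcongr
    linarith
  have bP : 200 * |β| ^ 3 * (3 / Real.sqrt d + n * skCube n) ≤ e := by
    rw [← hη']
    gcongr
  have up : ∀ Q : ℝ, (1 + δ - 1) * (β ^ 2 / 2 * (1 - Q)) ≤ p₁ - p + e →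
      β ^ 2 / 2 * (1 - Q) ≤ (p₁ - p) / δ + e / δ := fun Q h => by
    rw [← add_div, le_div_iff₀ h0]
    linarith
  have lo : ∀ Q : ℝ, (1 - δ + 4 * δ ^ 2 - 1) * (β ^ 2 / 2 * (1 - Q)) ≤ p₂ - p + e →
      -(β ^ 2 / 2 * (1 - Q)) ≤ (p₂ - p) / (δ - 4 * δ ^ 2) + 2 * e / δ := fun Q h => by
    have h2 : e / (δ - 4 * δ ^ 2) ≤ 2 * e / δ := by
      rw [div_le_div_iff₀ hδ h0]
      nlinarith [mul_nonneg he0.le (mul_nonneg h0.le (sub_nonneg.2 h1))]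
    have h3 : -(β ^ 2 / 2 * (1 - Q)) ≤ (p₂ - p) / (δ - 4 * δ ^ 2) + e / (δ - 4 * δ ^ 2) := by
      rw [← add_div, le_div_iff₀ hδ]
      linarith
    linarith
  have uG := up QG (hG1.trans (by linarith))
  have uP := up QP (hP1.trans (by linarith))
  have lG := lo QG (hG2.trans (by linarith))
  have lP := lo QP (hP2.trans (by linarith))
  have e1 : e / δ = β ^ 2 * (ε / 16) := by rw [he]; field_simp
  have e2 : 2 * e / δ = β ^ 2 * (ε / 8) := by rw [he]; field_simp; norm_num
  rw [e1] at uG uP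
  rw [e2] at lG lP
  have h8 : β ^ 2 * δ ≤ β ^ 2 * (ε / 24) := mul_le_mul_of_nonneg_left hδε hβ2.le
  rw [abs_le]
  constructor
  · refine le_of_mul_le_mul_left ?_ hβ2
    linarith [mul_pos hβ2 hε]
  · refine le_of_mul_le_mul_left ?_ hβ2
    linarith [mul_pos hβ2 hε]

end Conclusion

/-- average squared-overlap correspondence between the SK model
and the sparse model for the bisection Gibbs measures. -/
theorem stmt_5 (β : ℝ) :
    Tendsto (fun d : ℝ =>
      limsup (fun n : ℕ =>
        |(∫ g, avg2Bis β g (fun σ1 σ2 => (overlap σ1 σ2) ^ 2) ∂(skMeasure n)) -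
          ∫ A, avg2Bis (β / Real.sqrt d) (natMat A) (fun σ1 σ2 => (overlap σ1 σ2) ^ 2)
            ∂(sparseMeasure n d)|) atTop)
      atTop (nhds 0) := by
  have key : ∀ ε : ℝ, 0 < ε → ∀ᶠ d : ℝ in atTop, ∀ᶠ n : ℕ in atTop,
      |(∫ g, avg2Bis β g (fun σ1 σ2 => (overlap σ1 σ2) ^ 2) ∂(skMeasure n)) -
        ∫ A, avg2Bis (β / Real.sqrt d) (natMat A) (fun σ1 σ2 => (overlap σ1 σ2) ^ 2)
          ∂(sparseMeasure n d)| ≤ ε := fun ε hε => by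
    rcases eq_or_ne β 0 with rfl | hβ
    · refine Eventually.of_forall fun d => Eventually.of_forall fun n => ?_
      have := (inferInstance : IsProbabilityMeasure
        (Measure.pi fun _ : Fin n => Measure.pi fun _ : Fin n => gaussianReal 0 (1 / (2 * n))))
      have := (inferInstance : IsProbabilityMeasure (Measure.pi fun _ : Fin n =>
        Measure.pi fun _ : Fin n => poissonMeasure (d / (2 * n)).toNNReal))
      simp [avg2Bis_overlap, skMeasure, sparseMeasure, hε.le]
    · exact eventually_abs_overlap_sub_le hβ hε
  rw [Metric.tendsto_nhds]
  intro ε hε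
  filter_upwards [key (ε / 2) (half_pos hε)] with d hd
  rw [Real.dist_eq, sub_zero, abs_lt]
  have hbdd := isBoundedUnder_of_eventually_le hd
  have hle := limsup_le_of_le (hf := IsCoboundedUnder.of_frequently_ge (a := 0)
    (Eventually.of_forall fun n => abs_nonneg _).frequently) hd
  have hge := le_limsup_of_frequently_le (a := (0 : ℝ))
    (Eventually.of_forall fun n => abs_nonneg _).frequently hbdd
  constructor <;> linarith
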